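/- arXiv:1703.00135 — 2 statements merged into one kernel-verified Lean document; each statement's English description precedes it below -/
import Mathlib

section
/- Let 1 ≤ s ≤ N, 1 ≤ k ≤ m ≤ N, λ > 0, and set η = (s + λ²k)/min{s, λ²k}. Suppose A ∈ ℂ^{m×N} satisfies the Restricted Isometry Property for the sparse corruptions problem of order (2s, 2k) with constant δ_{2s,2k} < 1/√(1 + (1/(2√2) + √η)²). Then there exist constants C₃, C₄ > 0 depending only on δ_{2s,2k} such that: for any x ∈ ℂ^N, c ∈ ℂ^m, y ∈ ℂ^m and ε > 0 with ‖Ax + c − y‖₂ ≤ ε, and any minimizer (x̂, ĉ) of ‖z‖₁ + λ‖d‖₁ over pairs (z,d) subject to ‖Az + d − y‖₂ ≤ ε, one has ‖x − x̂‖₂ + ‖c − ĉ‖₂ ≤ C₃(1 + η^{1/4})·(σ_s(x)₁/√s + σ_k(c)₁/√k) + C₄(1 + η^{1/4})·ε. -/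
open Finset Matrix MeasureTheory

noncomputable def l1norm {n : ℕ} (x : Fin n → ℂ) : ℝ := ∑ i, ‖x i‖

noncomputable def l2norm {n : ℕ} (x : Fin n → ℂ) : ℝ := Real.sqrt (∑ i, ‖x i‖ ^ 2)

/-- The vector equal to `x` on `S` and zero elsewhere. -/
def restr {n : ℕ} (x : Fin n → ℂ) (S : Finset (Fin n)) : Fin n → ℂ :=
  fun i => if i ∈ S then x i else 0

/-- `x` has at most `s` nonzero entries. -/
def IsSparse {n : ℕ} (s : ℕ) (x : Fin n → ℂ) : Prop :=
  ∃ S : Finset (Fin n), S.card ≤ s ∧ ∀ i ∉ S, x i = 0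

/-- Best `s`-term approximation error of `x` in the `ℓ¹` norm. -/
noncomputable def sigma1 {n : ℕ} (s : ℕ) (x : Fin n → ℂ) : ℝ :=
  sInf {t : ℝ | ∃ z : Fin n → ℂ, IsSparse s z ∧ t = l1norm (x - z)}

/-- `η_{s,k}(λ) = (s + λ²k)/min{s, λ²k}`. -/
noncomputable def etaSK (s k : ℕ) (lam : ℝ) : ℝ :=
  ((s : ℝ) + lam ^ 2 * k) / min (s : ℝ) (lam ^ 2 * k)

/-- The ℓ¹-robust null space property of order (s,k) with weight lam, constants ρ, τ. -/
def L1RNSP {m N : ℕ} (A : Matrix (Fin m) (Fin N) ℂ) (s k : ℕ) (lam ρ τ : ℝ) : Prop :=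
  ∀ (x : Fin N → ℂ) (c : Fin m → ℂ) (S : Finset (Fin N)) (T : Finset (Fin m)),
    S.card ≤ s → T.card ≤ k →
      l1norm (restr x S) + lam * l1norm (restr c T) ≤
        ρ * (l1norm (restr x Sᶜ) + lam * l1norm (restr c Tᶜ)) + τ * l2norm (A.mulVec x + c)

/-- The ℓ²-robust null space property of order (s,k) with weight lam, constants ρ, τ. -/
def L2RNSP {m N : ℕ} (A : Matrix (Fin m) (Fin N) ℂ) (s k : ℕ) (lam ρ τ : ℝ) : Prop :=
  ∀ (x : Fin N → ℂ) (c : Fin m → ℂ) (S : Finset (Fin N)) (T : Finset (Fin m)),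
    S.card ≤ s → T.card ≤ k →
      Real.sqrt (l2norm (restr x S) ^ 2 + l2norm (restr c T) ^ 2) ≤
        (ρ / Real.sqrt ((s : ℝ) + lam ^ 2 * k)) *
            (l1norm (restr x Sᶜ) + lam * l1norm (restr c Tᶜ)) +
          τ * l2norm (A.mulVec x + c)

/-- `A` satisfies the two-sided RIP inequality for the sparse corruptions problem of
order `(s,k)` with constant `δ`. -/
def RIPCor {m N : ℕ} (A : Matrix (Fin m) (Fin N) ℂ) (s k : ℕ) (δ : ℝ) : Prop :=
  ∀ (x : Fin N → ℂ) (c : Fin m → ℂ), IsSparse s x → IsSparse k c →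
    (1 - δ) * (l2norm x ^ 2 + l2norm c ^ 2) ≤ l2norm (A.mulVec x + c) ^ 2 ∧
      l2norm (A.mulVec x + c) ^ 2 ≤ (1 + δ) * (l2norm x ^ 2 + l2norm c ^ 2)

/-- `A` satisfies the RIP inequality for sparse vectors of order `s` with constant `δ`. -/
def RIPSparse {m N : ℕ} (A : Matrix (Fin m) (Fin N) ℂ) (s : ℕ) (δ : ℝ) : Prop :=
  ∀ x : Fin N → ℂ, IsSparse s x →
    (1 - δ) * l2norm x ^ 2 ≤ l2norm (A.mulVec x) ^ 2 ∧
      l2norm (A.mulVec x) ^ 2 ≤ (1 + δ) * l2norm x ^ 2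

/-- `(xh, ch)` is a minimizer of `‖z‖₁ + lam ‖d‖₁` subject to `‖Az + d - y‖₂ ≤ ε`. -/
def IsMinimizer {m N : ℕ} (A : Matrix (Fin m) (Fin N) ℂ) (y : Fin m → ℂ) (lam ε : ℝ)
    (xh : Fin N → ℂ) (ch : Fin m → ℂ) : Prop :=
  l2norm (A.mulVec xh + ch - y) ≤ ε ∧
    ∀ (z : Fin N → ℂ) (d : Fin m → ℂ), l2norm (A.mulVec z + d - y) ≤ ε →
      l1norm xh + lam * l1norm ch ≤ l1norm z + lam * l1norm d

/-- Spectral norm of a matrix (operator norm w.r.t. Euclidean norms). -/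
noncomputable def specNorm {a b : ℕ} (B : Matrix (Fin a) (Fin b) ℂ) : ℝ :=
  ‖LinearMap.toContinuousLinearMap (Matrix.toEuclideanLin B)‖

/-- `σ_{s,k}(A)`: the maximum spectral norm over `k × s` submatrices of `A`. -/
noncomputable def sigmaSK {m N : ℕ} (A : Matrix (Fin m) (Fin N) ℂ) (s k : ℕ) : ℝ :=
  sSup {t : ℝ | ∃ (S : Finset (Fin N)) (T : Finset (Fin m)) (hS : S.card = s) (hT : T.card = k),
    t = specNorm (A.submatrix (fun i : Fin k => ((T.orderIsoOfFin hT i : Fin m)))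
      (fun j : Fin s => ((S.orderIsoOfFin hS j : Fin N))))}


lemma aux_block_ineq (r F Q2 lo M : ℝ) (hr : 0 < r) (hF : 0 ≤ F) (hlo : 0 ≤ lo) (hM : lo ≤ M)
    (h : Q2 ≤ (lo + M) * F - r ^ 2 * lo * M) :
    Real.sqrt Q2 ≤ F / r + r / 4 * (M - lo) := by
  apply Real.sqrt_le_iff.mpr
  have h1 : 0 ≤ F / r := by positivity
  refine ⟨by nlinarith [mul_nonneg hr.le (sub_nonneg.mpr hM)], h.trans ?_⟩
  obtain ⟨p, hp⟩ : ∃ p, p = F / r := ⟨_, rfl⟩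
  have hF' : F = p * r := by rw [hp]; field_simp
  rw [← hp, hF']
  have h2 : 0 ≤ (r * lo) * (r * M - r * lo) :=
    mul_nonneg (by positivity) (by nlinarith)
  nlinarith [sq_nonneg (p - (r * M + 3 * (r * lo)) / 4)]

lemma first_block {ι : Type*} [DecidableEq ι] (f : ι → ℝ) (hf : ∀ i, 0 ≤ f i) (s : ℕ) (hs : 1 ≤ s)
    (R : Finset ι) (M : ℝ) (hM : ∀ i ∈ R, f i ≤ M) (hM0 : 0 ≤ M) :
    ∃ R1 ⊆ R, ∃ lo : ℝ, R1.card ≤ s ∧ 0 ≤ lo ∧ (∀ i ∈ R \ R1, f i ≤ lo) ∧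
      (R.Nonempty → R1.Nonempty) ∧
      Real.sqrt (∑ i ∈ R1, f i ^ 2) ≤
        (∑ i ∈ R1, f i) / Real.sqrt s + Real.sqrt s / 4 * (M - lo) ∧
      lo * Real.sqrt s ≤ (∑ i ∈ R1, f i) / Real.sqrt s ∧
      ∀ U ⊆ R, U.card ≤ s → ∑ i ∈ U, f i ≤ ∑ i ∈ R1, f i := by
  have hs0 : (0 : ℝ) < s := by exact_mod_cast hs
  have hr : 0 < Real.sqrt s := Real.sqrt_pos.mpr hs0
  have hrr : Real.sqrt s ^ 2 = s := Real.sq_sqrt hs0.le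
  by_cases hc : R.card ≤ s
  · refine ⟨R, Finset.Subset.refl _, 0, hc, le_rfl, by simp, id, ?_, ?_, ?_⟩
    · apply aux_block_ineq _ _ _ _ _ hr (Finset.sum_nonneg fun i _ => hf i) le_rfl hM0
      simp only [zero_add, mul_zero, zero_mul, sub_zero]
      rw [Finset.mul_sum]
      apply Finset.sum_le_sum
      intro i hi
      nlinarith [hM i hi, hf i]
    · rw [zero_mul]; exact div_nonneg (Finset.sum_nonneg fun i _ => hf i) hr.le
    · intro U hU _
      exact Finset.sum_le_sum_of_subset_of_nonneg hU fun i _ _ => hf i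
  · push Not at hc
    have hne : (R.powersetCard s).Nonempty := Finset.powersetCard_nonempty.mpr hc.le
    obtain ⟨R1, hR1, hmax⟩ := Finset.exists_max_image _ (fun U => ∑ i ∈ U, f i) hne
    rw [Finset.mem_powersetCard] at hR1
    have hR1ne : R1.Nonempty := by rw [← Finset.card_pos]; omega
    obtain ⟨j, hj, hjmin⟩ := Finset.exists_min_image R1 f hR1ne
    have hle : ∀ i ∈ R \ R1, f i ≤ f j := by
      intro i hi
      rw [Finset.mem_sdiff] at hi
      have hi' : i ∉ R1.erase j := fun h => hi.2 (Finset.mem_of_mem_erase h)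
      have := hmax (insert i (R1.erase j)) (by
        rw [Finset.mem_powersetCard]
        constructor
        · intro a ha
          rw [Finset.mem_insert] at ha
          rcases ha with rfl | ha
          · exact hi.1
          · exact hR1.1 (Finset.mem_of_mem_erase ha)
        · rw [Finset.card_insert_of_notMem hi', Finset.card_erase_of_mem hj]
          omega)
      rw [Finset.sum_insert hi', ← Finset.add_sum_erase R1 f hj] at this
      linarith
    refine ⟨R1, hR1.1, f j, hR1.2.le, hf j, hle, fun _ => hR1ne, ?_, ?_, ?_⟩
    · apply aux_block_ineq _ _ _ _ _ hr (Finset.sum_nonneg fun i _ => hf i) (hf j)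
        (hM j (hR1.1 hj))
      have h1 : ∑ i ∈ R1, f i ^ 2 ≤ ∑ i ∈ R1, ((f j + M) * f i - f j * M) := by
        apply Finset.sum_le_sum
        intro i hi
        nlinarith [mul_nonneg (sub_nonneg.mpr (hjmin i hi)) (sub_nonneg.mpr (hM i (hR1.1 hi)))]
      rw [Finset.sum_sub_distrib, ← Finset.mul_sum, Finset.sum_const, hR1.2, nsmul_eq_mul] at h1
      rw [hrr]; linarith
    · rw [le_div_iff₀ hr]
      have h1 : ∑ i ∈ R1, f j ≤ ∑ i ∈ R1, f i := Finset.sum_le_sum fun i hi => hjmin i hi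
      rw [Finset.sum_const, hR1.2, nsmul_eq_mul] at h1
      rw [mul_assoc, Real.mul_self_sqrt hs0.le]; linarith
    · intro U hU hUc
      obtain ⟨V, hUV, hVR, hVc⟩ := Finset.exists_subsuperset_card_eq hU hUc hc.le
      exact (Finset.sum_le_sum_of_subset_of_nonneg hUV fun i _ _ => hf i).trans
        (hmax V (Finset.mem_powersetCard.mpr ⟨hVR, hVc⟩))

lemma restr_split {n : ℕ} (v : Fin n → ℂ) (R R1 : Finset (Fin n)) (h : R1 ⊆ R) :
    restr v R = restr v R1 + restr v (R \ R1) := by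
  funext i
  simp only [restr, Pi.add_apply, Finset.mem_sdiff]
  by_cases h1 : i ∈ R1
  · simp [h1, h h1]
  · simp [h1]

lemma sum_split {n : ℕ} (f : Fin n → ℝ) (R R1 : Finset (Fin n)) (h : R1 ⊆ R) :
    ∑ i ∈ R, f i = ∑ i ∈ R1, f i + ∑ i ∈ R \ R1, f i := by
  rw [add_comm, Finset.sum_sdiff h]

lemma tail_bound {n : ℕ} (v : Fin n → ℂ) (s : ℕ) (hs : 1 ≤ s) (φ : (Fin n → ℂ) → ℝ)
    (hadd : ∀ a b, φ (a + b) = φ a + φ b) (K : ℝ) (hK : 0 ≤ K) :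
    ∀ (c : ℕ) (R : Finset (Fin n)) (M : ℝ), R.card ≤ c → 0 ≤ M → (∀ i ∈ R, ‖v i‖ ≤ M) →
      (∀ U ⊆ R, U.card ≤ s → |φ (restr v U)| ≤ K * Real.sqrt (∑ i ∈ U, ‖v i‖ ^ 2)) →
      |φ (restr v R)| ≤ K * ((∑ i ∈ R, ‖v i‖) / Real.sqrt s + Real.sqrt s / 4 * M) := by
  intro c
  induction c with
  | zero =>
    intro R M hR hM0 hM hU
    have hR0 : R = ∅ := Finset.card_eq_zero.mp (by omega)
    have := hU R (Finset.Subset.refl _) (by omega)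
    refine this.trans ?_
    subst hR0
    simp only [Finset.sum_empty, Real.sqrt_zero, mul_zero, zero_div, zero_add]
    positivity
  | succ c ih =>
    intro R M hR hM0 hM hU
    obtain ⟨R1, hR1, lo, hc1, hlo, htail, hne, hblk, hlo2, -⟩ :=
      first_block (fun i => ‖v i‖) (fun i => norm_nonneg _) s hs R M hM hM0
    have hcard : (R \ R1).card ≤ c := by
      rw [Finset.card_sdiff_of_subset hR1]
      by_cases h0 : R.Nonempty
      · have := (hne h0).card_pos
        omega
      · rw [Finset.not_nonempty_iff_eq_empty] at h0
        simp [h0]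
    have h2 := ih (R \ R1) lo hcard hlo htail
      (fun U hUs hUc => hU U (hUs.trans Finset.sdiff_subset) hUc)
    have h1 := hU R1 hR1 hc1
    have h3 : K * Real.sqrt (∑ i ∈ R1, ‖v i‖ ^ 2) ≤ _ := mul_le_mul_of_nonneg_left hblk hK
    rw [restr_split v R R1 hR1, hadd, sum_split (fun i => ‖v i‖) R R1 hR1]
    refine (abs_add_le _ _).trans ?_
    calc _ ≤ _ := add_le_add (h1.trans h3) h2
      _ = _ := by ring

/-- Real part of the inner product. -/
noncomputable def ip {n : ℕ} (u w : Fin n → ℂ) : ℝ :=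
  ∑ i, ((u i).re * (w i).re + (u i).im * (w i).im)

lemma ip_add {n : ℕ} (u a b : Fin n → ℂ) : ip u (a + b) = ip u a + ip u b := by
  unfold ip
  rw [← Finset.sum_add_distrib]
  apply Finset.sum_congr rfl
  intro i _
  simp only [Pi.add_apply, Complex.add_re, Complex.add_im]
  ring

lemma l2sq {n : ℕ} (x : Fin n → ℂ) : l2norm x ^ 2 = ∑ i, ‖x i‖ ^ 2 :=
  Real.sq_sqrt (Finset.sum_nonneg fun i _ => by positivity)

lemma l2_nonneg {n : ℕ} (x : Fin n → ℂ) : 0 ≤ l2norm x := Real.sqrt_nonneg _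

lemma nsq (z : ℂ) : ‖z‖ ^ 2 = z.re ^ 2 + z.im ^ 2 := by
  rw [← Complex.normSq_eq_norm_sq, Complex.normSq_apply]; ring

lemma ip_self {n : ℕ} (u : Fin n → ℂ) : ip u u = l2norm u ^ 2 := by
  rw [l2sq]; unfold ip
  apply Finset.sum_congr rfl
  intro i _
  rw [nsq]; ring

lemma l2sq_add_smul {n : ℕ} (u w : Fin n → ℂ) (r : ℝ) :
    l2norm (u + (r : ℂ) • w) ^ 2 = l2norm u ^ 2 + 2 * r * ip u w + r ^ 2 * l2norm w ^ 2 := by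
  simp only [l2sq, ip, Finset.mul_sum, ← Finset.sum_add_distrib]
  apply Finset.sum_congr rfl
  intro i _
  simp only [nsq, Pi.add_apply, Pi.smul_apply, smul_eq_mul, Complex.add_re, Complex.add_im,
    Complex.re_ofReal_mul, Complex.im_ofReal_mul]
  ring

lemma ip_le {n : ℕ} (u w : Fin n → ℂ) : ip u w ≤ l2norm u * l2norm w := by
  refine le_trans ?_ (Real.sum_mul_le_sqrt_mul_sqrt Finset.univ (fun i => ‖u i‖) (fun i => ‖w i‖))
  apply Finset.sum_le_sum
  intro i _
  apply le_of_sq_le_sq _ (by positivity)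
  rw [mul_pow, nsq, nsq]
  nlinarith [sq_nonneg ((u i).re * (w i).im - (u i).im * (w i).re)]

lemma l2_tri {n : ℕ} (u w : Fin n → ℂ) : l2norm (u - w) ≤ l2norm u + l2norm w := by
  apply le_of_sq_le_sq _ (by have := l2_nonneg u; have := l2_nonneg w; positivity)
  have h := l2sq_add_smul u w (-1)
  have e : u + ((-1 : ℝ) : ℂ) • w = u - w := by
    funext i; simp [sub_eq_add_neg]
  rw [e] at h
  have e2 : ip u w = - ip u (-w) := by
    simp [ip, Finset.sum_add_distrib]; ring
  have e3 : l2norm (-w) = l2norm w := by simp [l2norm]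
  have := ip_le u (-w)
  rw [e3] at this
  nlinarith

lemma quad_lemma (a g b B2 D2 δ : ℝ) (hδ : 0 ≤ δ) (hB : 0 ≤ B2) (hD : 0 ≤ D2) (hδ1 : δ < 1)
    (h : ∀ r : ℝ, (1 - δ) * (B2 + r ^ 2 * D2) ≤ a + 2 * r * g + r ^ 2 * b ∧
      a + 2 * r * g + r ^ 2 * b ≤ (1 + δ) * (B2 + r ^ 2 * D2)) :
    g ^ 2 * B2 * (1 - δ ^ 2) ≤ δ ^ 2 * a ^ 2 * D2 := by
  have h1 := discrim_le_zero (a := (1 + δ) * D2 - b) (b := -2 * g) (c := (1 + δ) * B2 - a)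
    (fun r => by nlinarith [(h r).2])
  have h2 := discrim_le_zero (a := b - (1 - δ) * D2) (b := 2 * g) (c := a - (1 - δ) * B2)
    (fun r => by nlinarith [(h r).1])
  unfold discrim at h1 h2
  have he : 0 ≤ (1 + δ) * B2 - a := by have := (h 0).2; norm_num at this; linarith
  have hf : 0 ≤ a - (1 - δ) * B2 := by have := (h 0).1; norm_num at this; linarith
  rcases hδ.eq_or_lt with h0 | h0
  · subst h0
    have : (1 + 0) * B2 - a = 0 := by linarith
    rw [this] at h1
    have : g ^ 2 = 0 := le_antisymm (by nlinarith) (sq_nonneg g)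
    rw [this]; simp
  · obtain ⟨e, hee⟩ : ∃ e, e = (1 + δ) * B2 - a := ⟨_, rfl⟩
    obtain ⟨f, hff⟩ : ∃ f, f = a - (1 - δ) * B2 := ⟨_, rfl⟩
    rw [← hee] at h1 he
    rw [← hff] at h2 hf
    have h3 : g ^ 2 * B2 ≤ e * f * D2 := by
      have i1 := mul_le_mul_of_nonneg_left h1 hf
      have i2 := mul_le_mul_of_nonneg_left h2 he
      have i3 : 2 * δ * (g ^ 2 * B2) ≤ 2 * δ * (e * f * D2) := by
        have : 2 * δ * B2 = e + f := by rw [hee, hff]; ring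
        calc 2 * δ * (g ^ 2 * B2) = g ^ 2 * (2 * δ * B2) := by ring
          _ = g ^ 2 * (e + f) := by rw [this]
          _ ≤ _ := by nlinarith
      exact le_of_mul_le_mul_left i3 (by positivity)
    have h4 : e * f * (1 - δ ^ 2) ≤ δ ^ 2 * a ^ 2 := by
      rw [hee, hff]
      nlinarith [sq_nonneg (a - B2 + δ ^ 2 * B2)]
    have h5 : 0 ≤ 1 - δ ^ 2 := by nlinarith
    calc _ ≤ e * f * D2 * (1 - δ ^ 2) := mul_le_mul_of_nonneg_right h3 h5
      _ = e * f * (1 - δ ^ 2) * D2 := by ring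
      _ ≤ _ := mul_le_mul_of_nonneg_right h4 hD

lemma restr_l2sq {n : ℕ} (v : Fin n → ℂ) (S : Finset (Fin n)) :
    l2norm (restr v S) ^ 2 = ∑ i ∈ S, ‖v i‖ ^ 2 := by
  rw [l2sq, ← Finset.sum_filter_add_sum_filter_not Finset.univ (fun i => i ∈ S)]
  rw [Finset.sum_congr rfl (g := fun i => ‖v i‖ ^ 2), Finset.sum_eq_zero (s := {i | i ∉ S})]
  · simp
  · intro i hi; simp at hi; simp [restr, hi]
  · intro i hi; simp at hi; simp [restr, hi]

lemma restr_add_smul_l2sq {n : ℕ} (v : Fin n → ℂ) (S U : Finset (Fin n)) (h : Disjoint S U)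
    (r : ℝ) : l2norm (restr v S + (r : ℂ) • restr v U) ^ 2 =
      ∑ i ∈ S, ‖v i‖ ^ 2 + r ^ 2 * ∑ i ∈ U, ‖v i‖ ^ 2 := by
  rw [l2sq_add_smul, restr_l2sq, restr_l2sq]
  have : ip (restr v S) (restr v U) = 0 := by
    apply Finset.sum_eq_zero
    intro i _
    by_cases h1 : i ∈ S
    · have : i ∉ U := Finset.disjoint_left.mp h h1
      simp [restr, this]
    · simp [restr, h1]
  rw [this]; ring

lemma restr_add_smul_sparse {n : ℕ} (v : Fin n → ℂ) (S U : Finset (Fin n)) (s : ℕ)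
    (hS : S.card ≤ s) (hU : U.card ≤ s)
    (r : ℂ) : IsSparse (2 * s) (restr v S + r • restr v U) := by
  refine ⟨S ∪ U, (Finset.card_union_le _ _).trans (by omega), ?_⟩
  intro i hi
  simp only [Finset.mem_union, not_or] at hi
  simp [restr, hi.1, hi.2]

lemma rip_ip {m N s k : ℕ} (A : Matrix (Fin m) (Fin N) ℂ) (δ : ℝ) (hδ : 0 ≤ δ) (hδ1 : δ < 1)
    (hA : RIPCor A (2 * s) (2 * k) δ) (v : Fin N → ℂ) (d : Fin m → ℂ)
    (S U : Finset (Fin N)) (T V : Finset (Fin m)) (hS : S.card ≤ s) (hU : U.card ≤ s)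
    (hT : T.card ≤ k) (hV : V.card ≤ k) (hSU : Disjoint S U) (hTV : Disjoint T V)
    (B : ℝ) (hB : 0 < B) (hB2 : B ^ 2 = ∑ i ∈ S, ‖v i‖ ^ 2 + ∑ i ∈ T, ‖d i‖ ^ 2) :
    |ip (A.mulVec (restr v S) + restr d T) (A.mulVec (restr v U) + restr d V)| ≤
      (δ / Real.sqrt (1 - δ ^ 2) * l2norm (A.mulVec (restr v S) + restr d T) ^ 2 / B) *
        Real.sqrt (∑ i ∈ U, ‖v i‖ ^ 2 + ∑ i ∈ V, ‖d i‖ ^ 2) := by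
  set u := A.mulVec (restr v S) + restr d T with hu
  set w := A.mulVec (restr v U) + restr d V with hw
  have hD : 0 ≤ ∑ i ∈ U, ‖v i‖ ^ 2 + ∑ i ∈ V, ‖d i‖ ^ 2 := by positivity
  have h5 : 0 < 1 - δ ^ 2 := by nlinarith
  have key := quad_lemma (l2norm u ^ 2) (ip u w) (l2norm w ^ 2) (B ^ 2)
    (∑ i ∈ U, ‖v i‖ ^ 2 + ∑ i ∈ V, ‖d i‖ ^ 2) δ hδ (by positivity) hD hδ1 (by
      intro r
      have := hA (restr v S + (r : ℂ) • restr v U) (restr d T + (r : ℂ) • restr d V)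
        (restr_add_smul_sparse v S U s hS hU r) (restr_add_smul_sparse d T V k hT hV r)
      rw [restr_add_smul_l2sq v S U hSU, restr_add_smul_l2sq d T V hTV] at this
      have e : A.mulVec (restr v S + (r : ℂ) • restr v U) + (restr d T + (r : ℂ) • restr d V)
          = u + (r : ℂ) • w := by
        rw [hu, hw, Matrix.mulVec_add, Matrix.mulVec_smul, smul_add]
        abel
      rw [e, l2sq_add_smul] at this
      rw [hB2]
      constructor
      · calc _ = _ := by ring
          _ ≤ _ := this.1
      · calc _ ≤ _ := this.2
          _ = _ := by ring)
  apply abs_le_of_sq_le_sq _ (by have := l2_nonneg u; positivity)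
  rw [mul_pow, Real.sq_sqrt hD, div_pow, mul_pow, div_pow, Real.sq_sqrt h5.le]
  have : δ ^ 2 / (1 - δ ^ 2) * (l2norm u ^ 2) ^ 2 / B ^ 2 *
      (∑ i ∈ U, ‖v i‖ ^ 2 + ∑ i ∈ V, ‖d i‖ ^ 2) = 
      (δ ^ 2 * (l2norm u ^ 2) ^ 2 * (∑ i ∈ U, ‖v i‖ ^ 2 + ∑ i ∈ V, ‖d i‖ ^ 2)) /
        (B ^ 2 * (1 - δ ^ 2)) := by
    field_simp
  rw [this, le_div_iff₀ (by positivity)]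
  linarith

lemma restr_univ {n : ℕ} (v : Fin n → ℂ) : restr v Finset.univ = v := by
  funext i; simp [restr]

lemma restr_empty {n : ℕ} (v : Fin n → ℂ) : restr v ∅ = 0 := by
  funext i; simp [restr]

lemma top_struct {n : ℕ} (v : Fin n → ℂ) (s : ℕ) (hs : 1 ≤ s) :
    ∃ (S S1 : Finset (Fin n)) (t : ℝ), S.card ≤ s ∧ S1.card ≤ s ∧ S1 ⊆ Sᶜ ∧ 0 ≤ t ∧
      t ≤ (∑ i ∈ Sᶜ, ‖v i‖) / Real.sqrt s ∧
      Real.sqrt (∑ i ∈ S1, ‖v i‖ ^ 2) + t ≤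
        (∑ i ∈ Sᶜ, ‖v i‖) / Real.sqrt s + Real.sqrt (∑ i ∈ S, ‖v i‖ ^ 2) / 4 ∧
      ∑ i ∈ Sᶜ, ‖v i‖ ^ 2 ≤
        Real.sqrt (∑ i ∈ S, ‖v i‖ ^ 2) * ((∑ i ∈ Sᶜ, ‖v i‖) / Real.sqrt s) ∧
      ∑ i ∈ S, ‖v i‖ ≤ Real.sqrt s * Real.sqrt (∑ i ∈ S, ‖v i‖ ^ 2) ∧
      (∀ U : Finset (Fin n), U.card ≤ s → ∑ i ∈ U, ‖v i‖ ≤ ∑ i ∈ S, ‖v i‖) ∧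
      ∀ (φ : (Fin n → ℂ) → ℝ) (K : ℝ), (∀ a b, φ (a + b) = φ a + φ b) → 0 ≤ K →
        (∀ U ⊆ Sᶜ, U.card ≤ s → |φ (restr v U)| ≤ K * Real.sqrt (∑ i ∈ U, ‖v i‖ ^ 2)) →
        |φ (restr v (Sᶜ \ S1))| ≤ K * t := by
  have hs0 : (0 : ℝ) < s := by exact_mod_cast hs
  have hr : 0 < Real.sqrt s := Real.sqrt_pos.mpr hs0
  obtain ⟨S, -, M, hSc, hM0, hSt, -, -, hM, hmax⟩ :=
    first_block (fun i => ‖v i‖) (fun i => norm_nonneg _) s hs Finset.univ (∑ i, ‖v i‖)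
      (fun i hi => Finset.single_le_sum (f := fun i => ‖v i‖) (fun j _ => norm_nonneg _) hi)
      (Finset.sum_nonneg fun j _ => norm_nonneg _)
  have hSt' : ∀ i ∈ Sᶜ, ‖v i‖ ≤ M := by
    intro i hi
    apply hSt
    rw [← Finset.compl_eq_univ_sdiff]
    exact hi
  obtain ⟨S1, hS1, lo, hS1c, hlo, hS1t, -, hblk, hlo2, -⟩ :=
    first_block (fun i => ‖v i‖) (fun i => norm_nonneg _) s hs Sᶜ M hSt' hM0
  have hP : ∑ i ∈ S, ‖v i‖ ≤ Real.sqrt s * Real.sqrt (∑ i ∈ S, ‖v i‖ ^ 2) := by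
    rw [← Real.sqrt_mul hs0.le]
    apply Real.le_sqrt_of_sq_le
    refine (sq_sum_le_card_mul_sum_sq).trans ?_
    apply mul_le_mul_of_nonneg_right _ (by positivity)
    exact_mod_cast hSc
  have hMP : M * Real.sqrt s ≤ Real.sqrt (∑ i ∈ S, ‖v i‖ ^ 2) := by
    refine hM.trans ?_
    rw [div_le_iff₀ hr]; linarith
  have hsplit := sum_split (fun i => ‖v i‖) Sᶜ S1 hS1
  have hn1 : 0 ≤ ∑ i ∈ Sᶜ \ S1, ‖v i‖ := by positivity
  refine ⟨S, S1, (∑ i ∈ Sᶜ \ S1, ‖v i‖) / Real.sqrt s + Real.sqrt s / 4 * lo, hSc, hS1c, hS1,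
    by positivity, ?_, ?_, ?_, hP, fun U hU => hmax U (Finset.subset_univ _) hU, ?_⟩
  · rw [hsplit, add_div]
    nlinarith [mul_nonneg hlo hr.le]
  · rw [hsplit, add_div]
    nlinarith
  · have h1 : ∑ i ∈ Sᶜ, ‖v i‖ ^ 2 ≤ M * ∑ i ∈ Sᶜ, ‖v i‖ := by
      rw [Finset.mul_sum]
      apply Finset.sum_le_sum
      intro i hi
      nlinarith [hSt' i hi, norm_nonneg (v i)]
    refine h1.trans ?_
    have h2 : 0 ≤ (∑ i ∈ Sᶜ, ‖v i‖) / Real.sqrt s := by positivity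
    calc _ = M * Real.sqrt s * ((∑ i ∈ Sᶜ, ‖v i‖) / Real.sqrt s) := by field_simp
      _ ≤ _ := mul_le_mul_of_nonneg_right hMP h2
  · intro φ K hadd hK hU
    exact tail_bound v s hs φ hadd K hK _ _ lo le_rfl hlo hS1t
      (fun U hUs hUc => hU U (hUs.trans Finset.sdiff_subset) hUc)

lemma tail_arith (a b P Q X Y tv td B : ℝ) (ha : 0 ≤ a) (hb : 0 ≤ b)
    (hP : 0 ≤ P) (hQ : 0 ≤ Q) (hB : 0 ≤ B) (hB2 : B ^ 2 = P ^ 2 + Q ^ 2)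
    (h1 : tv ≤ X) (h2 : a + tv ≤ X + P / 4) (h3 : td ≤ Y) (h4 : b + td ≤ Y + Q / 4) :
    Real.sqrt (a ^ 2 + b ^ 2) + tv + td ≤ X + Y + 3 / 10 * B := by
  rcases le_total a b with h | h
  · have h5 : Real.sqrt (a ^ 2 + b ^ 2) ≤ b + a / 2 :=
      Real.sqrt_le_iff.mpr ⟨by positivity, by nlinarith⟩
    have h6 : P / 2 + Q ≤ 6 / 5 * B := by
      apply le_of_sq_le_sq _ (by positivity)
      nlinarith [sq_nonneg (P - Q / 2), sq_nonneg B]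
    linarith
  · have h5 : Real.sqrt (a ^ 2 + b ^ 2) ≤ a + b / 2 :=
      Real.sqrt_le_iff.mpr ⟨by positivity, by nlinarith⟩
    have h6 : P + Q / 2 ≤ 6 / 5 * B := by
      apply le_of_sq_le_sq _ (by positivity)
      nlinarith [sq_nonneg (P / 2 - Q), sq_nonneg B]
    linarith

set_option maxHeartbeats 1000000 in
lemma rip_core {m N s k : ℕ} (hs : 1 ≤ s) (hk : 1 ≤ k) (A : Matrix (Fin m) (Fin N) ℂ) (δ : ℝ)
    (hδ : 0 ≤ δ) (hδ1 : δ < 1) (hA : RIPCor A (2 * s) (2 * k) δ)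
    (v : Fin N → ℂ) (d : Fin m → ℂ) :
    ∃ (P Q X Y V1 D1 : ℝ), 0 ≤ P ∧ 0 ≤ Q ∧ 0 ≤ X ∧ 0 ≤ Y ∧
      l1norm v = V1 + Real.sqrt s * X ∧ l1norm d = D1 + Real.sqrt k * Y ∧
      V1 ≤ Real.sqrt s * P ∧ D1 ≤ Real.sqrt k * Q ∧
      l2norm v ^ 2 ≤ P ^ 2 + P * X ∧ l2norm d ^ 2 ≤ Q ^ 2 + Q * Y ∧
      (∀ U : Finset (Fin N), U.card ≤ s → ∑ i ∈ U, ‖v i‖ ≤ V1) ∧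
      (∀ U : Finset (Fin m), U.card ≤ k → ∑ i ∈ U, ‖d i‖ ≤ D1) ∧
      Real.sqrt (P ^ 2 + Q ^ 2) ≤ l2norm (A.mulVec v + d) / Real.sqrt (1 - δ) +
        δ / Real.sqrt (1 - δ ^ 2) * (X + Y + 3 / 10 * Real.sqrt (P ^ 2 + Q ^ 2)) := by
  have hs0 : (0 : ℝ) < s := by exact_mod_cast hs
  have hr : 0 < Real.sqrt s := Real.sqrt_pos.mpr hs0
  have hk0 : (0 : ℝ) < k := by exact_mod_cast hk
  have hrk : 0 < Real.sqrt k := Real.sqrt_pos.mpr hk0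
  obtain ⟨S, S1, tv, hS, hS1, hSS1, htv0, htvX, hav, hv2, hv1, hvmax, hvt⟩ := top_struct v s hs
  obtain ⟨T, T1, td, hT, hT1, hTT1, htd0, htdX, had, hd2, hd1, hdmax, hdt⟩ := top_struct d k hk
  have hP2 : Real.sqrt (∑ i ∈ S, ‖v i‖ ^ 2) ^ 2 = ∑ i ∈ S, ‖v i‖ ^ 2 :=
    Real.sq_sqrt (by positivity)
  have hQ2 : Real.sqrt (∑ i ∈ T, ‖d i‖ ^ 2) ^ 2 = ∑ i ∈ T, ‖d i‖ ^ 2 :=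
    Real.sq_sqrt (by positivity)
  set P := Real.sqrt (∑ i ∈ S, ‖v i‖ ^ 2) with hPdef
  set Q := Real.sqrt (∑ i ∈ T, ‖d i‖ ^ 2) with hQdef
  set X := (∑ i ∈ Sᶜ, ‖v i‖) / Real.sqrt s with hXdef
  set Y := (∑ i ∈ Tᶜ, ‖d i‖) / Real.sqrt k with hYdef
  have hP : 0 ≤ P := Real.sqrt_nonneg _
  have hQ : 0 ≤ Q := Real.sqrt_nonneg _
  have hX : 0 ≤ X := by positivity
  have hY : 0 ≤ Y := by positivity
  refine ⟨P, Q, X, Y, ∑ i ∈ S, ‖v i‖, ∑ i ∈ T, ‖d i‖, hP, hQ, hX, hY, ?_, ?_, hv1, hd1,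
    ?_, ?_, hvmax, hdmax, ?_⟩
  · rw [hXdef, mul_div_cancel₀ _ hr.ne', Finset.sum_add_sum_compl]; rfl
  · rw [hYdef, mul_div_cancel₀ _ hrk.ne', Finset.sum_add_sum_compl]; rfl
  · rw [l2sq, ← Finset.sum_add_sum_compl S, hP2]; linarith
  · rw [l2sq, ← Finset.sum_add_sum_compl T, hQ2]; linarith
  set B := Real.sqrt (P ^ 2 + Q ^ 2) with hBdef
  have hBB : B ^ 2 = P ^ 2 + Q ^ 2 := Real.sq_sqrt (by positivity)
  have hB0 : 0 ≤ B := Real.sqrt_nonneg _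
  have hd : 0 < Real.sqrt (1 - δ) := Real.sqrt_pos.mpr (by linarith)
  have hq : 0 ≤ δ / Real.sqrt (1 - δ ^ 2) := by positivity
  rcases hB0.eq_or_lt with hB | hB
  · rw [← hB]
    have := l2_nonneg (A.mulVec v + d)
    positivity
  have hB2 : B ^ 2 = ∑ i ∈ S, ‖v i‖ ^ 2 + ∑ i ∈ T, ‖d i‖ ^ 2 := by rw [hBB, hP2, hQ2]
  have hdisjS : ∀ U ⊆ Sᶜ, Disjoint S U := fun U hU =>
    Finset.disjoint_of_subset_right hU disjoint_compl_right
  have hdisjT : ∀ U ⊆ Tᶜ, Disjoint T U := fun U hU =>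
    Finset.disjoint_of_subset_right hU disjoint_compl_right
  have hip := fun (U : Finset (Fin N)) (V : Finset (Fin m)) hU hV hU' hV' =>
    rip_ip A δ hδ hδ1 hA v d S U T V hS hU hT hV (hdisjS U hU') (hdisjT V hV') B hB hB2
  set u := A.mulVec (restr v S) + restr d T with hu
  have hripu := (hA (restr v S) (restr d T)
    ⟨S, by omega, fun i hi => by simp [restr, hi]⟩ ⟨T, by omega, fun i hi => by simp [restr, hi]⟩).1
  rw [restr_l2sq, restr_l2sq, ← hB2, ← hu] at hripu
  set q := δ / Real.sqrt (1 - δ ^ 2) with hqdef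
  have hUn : 0 ≤ l2norm u := l2_nonneg u
  have hK : 0 ≤ q * l2norm u ^ 2 / B := by positivity
  have b1 := hip S1 T1 hS1 hT1 hSS1 hTT1
  have b2 := hvt (fun z => ip u (A.mulVec z)) (q * l2norm u ^ 2 / B)
    (fun a b => by simp only [Matrix.mulVec_add, ip_add]) hK (fun U hU hUc => by
      have := hip U ∅ hUc (by simp) hU (by simp)
      rw [restr_empty, add_zero, Finset.sum_empty, add_zero] at this
      exact this)
  have b3 := hdt (fun z => ip u z) (q * l2norm u ^ 2 / B)
    (fun a b => ip_add u a b) hK (fun U hU hUc => by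
      have := hip ∅ U (by simp) hUc (by simp) hU
      rw [restr_empty, Matrix.mulVec_zero, zero_add, Finset.sum_empty, zero_add] at this
      exact this)
  have hdec : A.mulVec v + d = u + ((A.mulVec (restr v S1) + restr d T1) +
      (A.mulVec (restr v (Sᶜ \ S1)) + restr d (Tᶜ \ T1))) := by
    have e1 : v = restr v S + (restr v S1 + restr v (Sᶜ \ S1)) := by
      rw [← restr_split v Sᶜ S1 hSS1, Finset.compl_eq_univ_sdiff,
        ← restr_split v _ S (Finset.subset_univ _), restr_univ]
    have e2 : d = restr d T + (restr d T1 + restr d (Tᶜ \ T1)) := by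
      rw [← restr_split d Tᶜ T1 hTT1, Finset.compl_eq_univ_sdiff,
        ← restr_split d _ T (Finset.subset_univ _), restr_univ]
    conv_lhs => rw [e1, e2]
    rw [hu, Matrix.mulVec_add, Matrix.mulVec_add]
    abel
  have hcs := ip_le u (A.mulVec v + d)
  set E := l2norm (A.mulVec v + d) with hE
  have hE0 : 0 ≤ E := l2_nonneg _
  rw [hdec, ip_add u u, ip_self, ip_add,
    ip_add u (A.mulVec (restr v (Sᶜ \ S1)))] at hcs
  have htail := tail_arith (Real.sqrt (∑ i ∈ S1, ‖v i‖ ^ 2)) (Real.sqrt (∑ i ∈ T1, ‖d i‖ ^ 2))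
    P Q X Y tv td B (Real.sqrt_nonneg _) (Real.sqrt_nonneg _) hP hQ hB0 hBB htvX hav htdX had
  rw [Real.sq_sqrt (by positivity), Real.sq_sqrt (by positivity)] at htail
  have hmul := mul_le_mul_of_nonneg_left htail hK
  have hfin : l2norm u ^ 2 ≤ l2norm u * E + q * l2norm u ^ 2 / B * (X + Y + 3 / 10 * B) := by
    have c1 := neg_abs_le (ip u (A.mulVec (restr v S1) + restr d T1))
    have c2 := neg_abs_le (ip u (A.mulVec (restr v (Sᶜ \ S1))))
    have c3 := neg_abs_le (ip u (restr d (Tᶜ \ T1)))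
    rw [mul_add, mul_add] at hmul
    linarith
  have hUB : Real.sqrt (1 - δ) * B ≤ l2norm u := by
    apply le_of_sq_le_sq _ hUn
    rw [mul_pow, Real.sq_sqrt (by linarith)]; exact hripu
  have hUpos : 0 < l2norm u := lt_of_lt_of_le (by positivity) hUB
  have h1 : B ≤ E * B / l2norm u + q * (X + Y + 3 / 10 * B) := by
    have : l2norm u ^ 2 * B ≤ l2norm u ^ 2 * (E * B / l2norm u + q * (X + Y + 3 / 10 * B)) := by
      calc _ ≤ _ := mul_le_mul_of_nonneg_right hfin hB0
        _ = _ := by field_simp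
    exact le_of_mul_le_mul_left this (by positivity)
  have h2 : E * B / l2norm u ≤ E / Real.sqrt (1 - δ) := by
    rw [div_le_div_iff₀ hUpos hd]
    have := mul_le_mul_of_nonneg_left hUB hE0
    linarith
  linarith

lemma l1_cone {n : ℕ} (x xh z : Fin n → ℂ) (U : Finset (Fin n)) (hz : ∀ i ∉ U, z i = 0) :
    l1norm x + l1norm (x - xh) - 2 * ∑ i ∈ U, ‖(x - xh) i‖ - 2 * l1norm (x - z) ≤
      l1norm xh := by
  have e : ∑ i ∈ U, ‖(x - xh) i‖ = ∑ i, if i ∈ U then ‖(x - xh) i‖ else 0 := by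
    simp
  rw [e]
  unfold l1norm
  rw [Finset.mul_sum, Finset.mul_sum, ← Finset.sum_add_distrib, ← Finset.sum_sub_distrib,
    ← Finset.sum_sub_distrib]
  apply Finset.sum_le_sum
  intro i _
  simp only [Pi.sub_apply]
  by_cases h : i ∈ U
  · simp only [h, if_true]
    have h1 : ‖x i‖ ≤ ‖xh i‖ + ‖x i - xh i‖ := by
      calc ‖x i‖ = ‖xh i + (x i - xh i)‖ := by congr 1; ring
        _ ≤ _ := norm_add_le _ _
    have := norm_nonneg (x i - z i)
    linarith
  · simp only [h, if_false, hz i h, sub_zero]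
    have h1 := norm_sub_le (x i) (xh i)
    linarith

lemma le_sigma1 {n s : ℕ} (x : Fin n → ℂ) (a : ℝ)
    (h : ∀ z, IsSparse s z → a ≤ l1norm (x - z)) : a ≤ sigma1 s x := by
  apply le_csInf
  · exact ⟨_, 0, ⟨∅, by simp, by simp⟩, rfl⟩
  · rintro t ⟨z, hz, rfl⟩
    exact h z hz

lemma sigma1_nonneg {n s : ℕ} (x : Fin n → ℂ) : 0 ≤ sigma1 s x :=
  le_sigma1 x 0 fun z _ => Finset.sum_nonneg fun i _ => norm_nonneg _

lemma cs2 (a b P Q G B : ℝ) (hG : 0 ≤ G) (hB : 0 ≤ B) (hG2 : G ^ 2 = a ^ 2 + b ^ 2)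
    (hB2 : B ^ 2 = P ^ 2 + Q ^ 2) : a * P + b * Q ≤ G * B := by
  apply le_of_sq_le_sq _ (by positivity)
  rw [mul_pow, hG2, hB2]
  nlinarith [sq_nonneg (a * Q - b * P)]

lemma xy_bound (a b h X Y P Q B sx sc : ℝ) (ha : 0 < a) (hb : 0 < b) (hh : 0 ≤ h)
    (hX : 0 ≤ X) (hY : 0 ≤ Y) (hB : 0 ≤ B) (hsx : 0 ≤ sx) (hsc : 0 ≤ sc)
    (hB2 : B ^ 2 = P ^ 2 + Q ^ 2)
    (heta : h ^ 2 = (a ^ 2 + b ^ 2) / min (a ^ 2) (b ^ 2))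
    (hc : a * X + b * Y ≤ a * P + b * Q + 2 * (a * sx + b * sc)) :
    X + Y ≤ h * (B + 2 * (sx + sc)) := by
  have hg : 0 < min a b := lt_min ha hb
  have hg2 : (min a b) ^ 2 = min (a ^ 2) (b ^ 2) := by
    rcases le_total a b with h | h
    · rw [min_eq_left h, min_eq_left (by gcongr)]
    · rw [min_eq_right h, min_eq_right (by gcongr)]
  have hG2 : (h * min a b) ^ 2 = a ^ 2 + b ^ 2 := by
    rw [mul_pow, heta, hg2, div_mul_cancel₀]
    rw [← hg2]; positivity
  have hG : 0 ≤ h * min a b := by positivity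
  have h1 := cs2 a b P Q _ B hG hB hG2 hB2
  have haG : a ≤ h * min a b := le_of_sq_le_sq (by nlinarith) hG
  have hbG : b ≤ h * min a b := le_of_sq_le_sq (by nlinarith) hG
  have h2 : min a b * (X + Y) ≤ min a b * (h * (B + 2 * (sx + sc))) := by
    have i1 := mul_le_mul_of_nonneg_right (min_le_left a b) hX
    have i2 := mul_le_mul_of_nonneg_right (min_le_right a b) hY
    have i3 := mul_le_mul_of_nonneg_right haG hsx
    have i4 := mul_le_mul_of_nonneg_right hbG hsc
    nlinarith
  exact le_of_mul_le_mul_left h2 hg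

lemma l2_bound (l P X B h e Sg : ℝ) (hl : l ^ 2 ≤ P ^ 2 + P * X) (hP : 0 ≤ P) (hPB : P ≤ B)
    (hX : X ≤ h * (B + 2 * Sg)) (he : 0 ≤ e) (heh : e ^ 2 = h) (hS : 0 ≤ Sg) :
    l ≤ B + e * (B + Sg) := by
  have hB : 0 ≤ B := hP.trans hPB
  apply le_of_sq_le_sq _ (by positivity)
  refine hl.trans ?_
  have hh : 0 ≤ h := by rw [← heh]; positivity
  have h1 : P * X ≤ B * (h * (B + 2 * Sg)) := by
    calc P * X ≤ P * (h * (B + 2 * Sg)) := mul_le_mul_of_nonneg_left hX hP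
      _ ≤ _ := mul_le_mul_of_nonneg_right hPB (by positivity)
  have h2 : P ^ 2 ≤ B ^ 2 := by gcongr
  have h3 : 0 ≤ B * (e * (B + Sg)) := by positivity
  have h4 : 0 ≤ h * Sg ^ 2 := by positivity
  have h5 : (e * (B + Sg)) ^ 2 = h * (B + Sg) ^ 2 := by rw [mul_pow, heh]
  nlinarith

lemma thresh (δ h : ℝ) (hδ : 0 ≤ δ) (hh : 0 ≤ h)
    (hlt : δ < 1 / Real.sqrt (1 + (1 / (2 * Real.sqrt 2) + h) ^ 2)) :
    δ < 1 ∧ δ / Real.sqrt (1 - δ ^ 2) * (h + 7 / 20) ≤ 1 := by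
  have hw : (7 / 20 : ℝ) ≤ 1 / (2 * Real.sqrt 2) := by
    have : Real.sqrt 2 ≤ 142 / 100 := Real.sqrt_le_iff.mpr ⟨by norm_num, by norm_num⟩
    have h2 : 0 < Real.sqrt 2 := by positivity
    rw [div_le_div_iff₀ (by norm_num) (by positivity)]
    linarith
  set w := 1 / (2 * Real.sqrt 2) + h with hwdef
  have hw0 : 0 ≤ w := by positivity
  have hs : 0 < Real.sqrt (1 + w ^ 2) := Real.sqrt_pos.mpr (by positivity)
  rw [lt_div_iff₀ hs] at hlt
  have h1 : δ ^ 2 * (1 + w ^ 2) < 1 := by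
    have : (δ * Real.sqrt (1 + w ^ 2)) ^ 2 < 1 :=
      pow_lt_one₀ (by positivity) hlt (by norm_num)
    rwa [mul_pow, Real.sq_sqrt (by positivity)] at this
  have h2 : δ ^ 2 < 1 := by nlinarith [mul_nonneg (sq_nonneg δ) (sq_nonneg w)]
  have hp : 0 < Real.sqrt (1 - δ ^ 2) := Real.sqrt_pos.mpr (by linarith)
  refine ⟨by nlinarith, ?_⟩
  rw [div_mul_eq_mul_div, div_le_one hp]
  calc δ * (h + 7 / 20) ≤ δ * w := mul_le_mul_of_nonneg_left (by linarith) hδ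
    _ ≤ _ := Real.le_sqrt_of_sq_le (by nlinarith)

set_option maxHeartbeats 1000000 in
lemma recovery_aux (δ : ℝ) (hδ0 : 0 ≤ δ) (g0 : ℝ) (hg0 : 0 < g0)
    (hg : ∀ h : ℝ, 0 ≤ h → δ / Real.sqrt (1 - δ ^ 2) * (h + 7 / 20) ≤ 1 →
      g0 ≤ 1 - δ / Real.sqrt (1 - δ ^ 2) * (h + 3 / 10))
    (N m s k : ℕ) (hs : 1 ≤ s) (hk : 1 ≤ k) (lam : ℝ) (hlam : 0 < lam)
    (hlt : δ < 1 / Real.sqrt (1 + (1 / (2 * Real.sqrt 2) + Real.sqrt (etaSK s k lam)) ^ 2))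
    (A : Matrix (Fin m) (Fin N) ℂ) (hA : RIPCor A (2 * s) (2 * k) δ)
    (x : Fin N → ℂ) (c y : Fin m → ℂ) (ε : ℝ)
    (hy : l2norm (A.mulVec x + c - y) ≤ ε)
    (xh : Fin N → ℂ) (ch : Fin m → ℂ) (hmin : IsMinimizer A y lam ε xh ch) :
    l2norm (x - xh) + l2norm (c - ch) ≤
      (2 * (2 / g0 + 1)) * (1 + etaSK s k lam ^ ((1 : ℝ) / 4)) *
          (sigma1 s x / Real.sqrt (s : ℝ) + sigma1 k c / Real.sqrt (k : ℝ)) +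
        (4 / (Real.sqrt (1 - δ) * g0)) * (1 + etaSK s k lam ^ ((1 : ℝ) / 4)) * ε := by
  have hs0 : (0 : ℝ) < s := by exact_mod_cast hs
  have hr : 0 < Real.sqrt s := Real.sqrt_pos.mpr hs0
  have hk0 : (0 : ℝ) < k := by exact_mod_cast hk
  have hrk : 0 < Real.sqrt k := Real.sqrt_pos.mpr hk0
  have hη0 : 0 ≤ etaSK s k lam := by unfold etaSK; positivity
  obtain ⟨hδ1, hq1⟩ := thresh δ _ hδ0 (Real.sqrt_nonneg _) hlt
  have hgg := hg _ (Real.sqrt_nonneg _) hq1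
  have hh0 := Real.sqrt_nonneg (etaSK s k lam)
  have hh2 : Real.sqrt (etaSK s k lam) ^ 2 = etaSK s k lam := Real.sq_sqrt hη0
  have he0 : 0 ≤ etaSK s k lam ^ ((1 : ℝ) / 4) := Real.rpow_nonneg hη0 _
  have he2 : (etaSK s k lam ^ ((1 : ℝ) / 4)) ^ 2 = Real.sqrt (etaSK s k lam) := by
    rw [Real.sqrt_eq_rpow, ← Real.rpow_natCast, ← Real.rpow_mul hη0]
    norm_num
  obtain ⟨P, Q, X, Y, V1, D1, hP, hQ, hX, hY, hl1v, hl1d, hV1, hD1, hl2v, hl2d, hmaxv, hmaxd,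
    hcore⟩ := rip_core hs hk A δ hδ0 hδ1 hA (x - xh) (c - ch)
  have hE : l2norm (A.mulVec (x - xh) + (c - ch)) ≤ 2 * ε := by
    have e : A.mulVec (x - xh) + (c - ch) = (A.mulVec x + c - y) - (A.mulVec xh + ch - y) := by
      rw [Matrix.mulVec_sub]; abel
    rw [e]
    refine (l2_tri _ _).trans ?_
    linarith [hmin.1]
  have hcone : l1norm (x - xh) + lam * l1norm (c - ch) ≤
      2 * (V1 + lam * D1) + 2 * (sigma1 s x + lam * sigma1 k c) := by
    have hm := hmin.2 x c hy
    have h1 : ∀ z', IsSparse k z' → (l1norm (x - xh) + lam * l1norm (c - ch) -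
        2 * (V1 + lam * D1) - 2 * lam * l1norm (c - z')) / 2 ≤ sigma1 s x := by
      rintro z' ⟨U', hU', hz'⟩
      apply le_sigma1
      rintro z ⟨U, hU, hz⟩
      have i1 := l1_cone x xh z U hz
      have i2 := mul_le_mul_of_nonneg_left (l1_cone c ch z' U' hz') hlam.le
      have i3 := hmaxv U hU
      have i4 := mul_le_mul_of_nonneg_left (hmaxd U' hU') hlam.le
      linarith
    have h2 : (l1norm (x - xh) + lam * l1norm (c - ch) -
        2 * (V1 + lam * D1) - 2 * sigma1 s x) / (2 * lam) ≤ sigma1 k c := by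
      apply le_sigma1
      intro z' hz'
      rw [div_le_iff₀ (by positivity)]
      linarith [h1 z' hz']
    rw [div_le_iff₀ (by positivity)] at h2
    linarith
  have hsx0 := sigma1_nonneg (s := s) x
  have hsc0 := sigma1_nonneg (s := k) c
  obtain ⟨sx, hsx⟩ : ∃ t, t = sigma1 s x / Real.sqrt (s : ℝ) := ⟨_, rfl⟩
  obtain ⟨sc, hsc⟩ : ∃ t, t = sigma1 k c / Real.sqrt (k : ℝ) := ⟨_, rfl⟩
  have hsxn : 0 ≤ sx := by rw [hsx]; positivity
  have hscn : 0 ≤ sc := by rw [hsc]; positivity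
  have hsx' : sigma1 s x = Real.sqrt s * sx := by rw [hsx]; field_simp
  have hsc' : sigma1 k c = Real.sqrt k * sc := by rw [hsc]; field_simp
  rw [← hsx, ← hsc]
  have hBB : Real.sqrt (P ^ 2 + Q ^ 2) ^ 2 = P ^ 2 + Q ^ 2 := Real.sq_sqrt (by positivity)
  have hB0 := Real.sqrt_nonneg (P ^ 2 + Q ^ 2)
  set B := Real.sqrt (P ^ 2 + Q ^ 2) with hB
  have hPB : P ≤ B := le_of_sq_le_sq (by nlinarith [sq_nonneg Q]) hB0
  have hQB : Q ≤ B := le_of_sq_le_sq (by nlinarith [sq_nonneg P]) hB0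
  have hXY := xy_bound (Real.sqrt s) (lam * Real.sqrt k) (Real.sqrt (etaSK s k lam)) X Y P Q B
    sx sc hr (by positivity) hh0 hX hY hB0 hsxn hscn hBB (by
      rw [hh2, mul_pow, Real.sq_sqrt hs0.le, Real.sq_sqrt hk0.le]; rfl) (by
      have := mul_le_mul_of_nonneg_left hD1 hlam.le
      rw [hl1v, hl1d, hsx', hsc'] at hcone
      nlinarith)
  set h := Real.sqrt (etaSK s k lam) with hh
  set e := etaSK s k lam ^ ((1 : ℝ) / 4) with he
  have hd : 0 < Real.sqrt (1 - δ) := Real.sqrt_pos.mpr (by linarith)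
  have hv := l2_bound _ P X B h e (sx + sc) hl2v hP hPB (by linarith) he0 he2 (by positivity)
  have hw := l2_bound _ Q Y B h e (sx + sc) hl2d hQ hQB (by linarith) he0 he2 (by positivity)
  have hq : 0 ≤ δ / Real.sqrt (1 - δ ^ 2) := by positivity
  set q := δ / Real.sqrt (1 - δ ^ 2) with hqdef
  have hEd : l2norm (A.mulVec (x - xh) + (c - ch)) / Real.sqrt (1 - δ) ≤
      2 * ε / Real.sqrt (1 - δ) := by gcongr
  have hgB : g0 * B ≤ 2 * ε / Real.sqrt (1 - δ) + 2 * (sx + sc) := by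
    have i1 := mul_le_mul_of_nonneg_left hXY hq
    have i2 : q * h ≤ 1 := by nlinarith
    have i3 := mul_le_mul_of_nonneg_right i2 (add_nonneg hsxn hscn)
    have i4 := mul_le_mul_of_nonneg_right hgg hB0
    nlinarith
  have hBf : B ≤ 2 / (Real.sqrt (1 - δ) * g0) * ε + 2 / g0 * (sx + sc) := by
    have : B ≤ (2 * ε / Real.sqrt (1 - δ) + 2 * (sx + sc)) / g0 := by
      rw [le_div_iff₀ hg0]; linarith
    refine this.trans (le_of_eq ?_)
    field_simp
  have htot : l2norm (x - xh) + l2norm (c - ch) ≤ 2 * (1 + e) * (B + (sx + sc)) := by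
    have : 2 * (1 + e) * (B + (sx + sc)) =
      2 * (B + e * (B + (sx + sc))) + 2 * (sx + sc) := by ring
    rw [this]
    linarith
  refine htot.trans ?_
  calc 2 * (1 + e) * (B + (sx + sc)) ≤ 2 * (1 + e) *
        ((2 / (Real.sqrt (1 - δ) * g0) * ε + 2 / g0 * (sx + sc)) + (sx + sc)) := by gcongr
    _ = _ := by ring

/-- ℓ² recovery estimate under the RIP for sparse corruptions, with constants
depending only on the restricted isometry constant δ. -/
theorem l2_recovery_of_rip (δ : ℝ) (hδ0 : 0 ≤ δ) :
    ∃ C₃ C₄ : ℝ, 0 < C₃ ∧ 0 < C₄ ∧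
      ∀ (N m s k : ℕ), 1 ≤ s → s ≤ N → 1 ≤ k → k ≤ m → m ≤ N →
        ∀ lam : ℝ, 0 < lam →
          δ < 1 / Real.sqrt (1 + (1 / (2 * Real.sqrt 2) + Real.sqrt (etaSK s k lam)) ^ 2) →
          ∀ A : Matrix (Fin m) (Fin N) ℂ, RIPCor A (2 * s) (2 * k) δ →
            ∀ (x : Fin N → ℂ) (c y : Fin m → ℂ) (ε : ℝ), 0 < ε →
              l2norm (A.mulVec x + c - y) ≤ ε →
              ∀ (xh : Fin N → ℂ) (ch : Fin m → ℂ), IsMinimizer A y lam ε xh ch →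
                l2norm (x - xh) + l2norm (c - ch) ≤
                  C₃ * (1 + etaSK s k lam ^ ((1 : ℝ) / 4)) *
                      (sigma1 s x / Real.sqrt (s : ℝ) + sigma1 k c / Real.sqrt (k : ℝ)) +
                    C₄ * (1 + etaSK s k lam ^ ((1 : ℝ) / 4)) * ε := by
  by_cases hδ1 : δ < 1
  · have hd : 0 < Real.sqrt (1 - δ) := Real.sqrt_pos.mpr (by linarith)
    have hd2 : 0 < Real.sqrt (1 - δ ^ 2) := Real.sqrt_pos.mpr (by nlinarith)
    obtain ⟨g0, hg0, hg⟩ : ∃ g0 : ℝ, 0 < g0 ∧ ∀ h : ℝ, 0 ≤ h →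
        δ / Real.sqrt (1 - δ ^ 2) * (h + 7 / 20) ≤ 1 →
        g0 ≤ 1 - δ / Real.sqrt (1 - δ ^ 2) * (h + 3 / 10) := by
      rcases hδ0.eq_or_lt with h0 | h0
      · exact ⟨1, one_pos, fun h _ _ => by rw [← h0]; simp⟩
      · refine ⟨δ / Real.sqrt (1 - δ ^ 2) * (1 / 20), by positivity, fun h _ h1 => ?_⟩
        linarith
    refine ⟨2 * (2 / g0 + 1), 4 / (Real.sqrt (1 - δ) * g0), by positivity, by positivity, ?_⟩
    intro N m s k hs _ hk _ _ lam hlam hlt A hA x c y ε _ hy xh ch hmin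
    exact recovery_aux δ hδ0 g0 hg0 hg N m s k hs hk lam hlam hlt A hA x c y ε hy xh ch hmin
  · refine ⟨1, 1, one_pos, one_pos, ?_⟩
    intro N m s k _ _ _ _ _ lam _ hlt
    exact absurd (thresh δ _ hδ0 (Real.sqrt_nonneg _) hlt).1 hδ1
end

section
/- There exist universal constants c₁, c₂ > 0 such that the following holds. Let 0 < δ, ε < 1, 1 ≤ s ≤ N, 1 ≤ k ≤ m, and suppose m ≥ c₁·δ^{−2}·(s·log(2N/s) + log(2/ε)) and m ≥ c₂·δ^{−2}·k·log(1/δ) (with δ ≤ 1/2, say, so that log(1/δ) > 0). Let A ∈ ℝ^{m×N} be a random matrix whose entries are independent standard Gaussian random variables (mean zero, variance 1). Then with probability at least 1 − ε, the matrix (1/√m)·A has the Restricted Isometry Property for the sparse corruptions problem of order (s,k) with constant δ_{s,k} ≤ δ. -/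
open Finset Matrix MeasureTheory ProbabilityTheory

noncomputable def l2normR {n : ℕ} (x : Fin n → ℝ) : ℝ := Real.sqrt (∑ i, x i ^ 2)

/-- `x` has at most `s` nonzero entries. -/
def IsSparseR {n : ℕ} (s : ℕ) (x : Fin n → ℝ) : Prop :=
  ∃ S : Finset (Fin n), S.card ≤ s ∧ ∀ i ∉ S, x i = 0

/-- `B` satisfies the two-sided RIP inequality for the sparse corruptions problem of
order `(s,k)` with constant `δ` (real version). -/
def RIPCorR {m N : ℕ} (B : Matrix (Fin m) (Fin N) ℝ) (s k : ℕ) (δ : ℝ) : Prop :=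
  ∀ (x : Fin N → ℝ) (c : Fin m → ℝ), IsSparseR s x → IsSparseR k c →
    (1 - δ) * (l2normR x ^ 2 + l2normR c ^ 2) ≤ l2normR (B.mulVec x + c) ^ 2 ∧
      l2normR (B.mulVec x + c) ^ 2 ≤ (1 + δ) * (l2normR x ^ 2 + l2normR c ^ 2)


lemma law_aux {N : ℕ} (y : Fin N → ℝ) (hy : ∑ i, y i ^ 2 = 1) :
    (Measure.pi fun _ : Fin N => gaussianReal 0 1).map (fun a => ∑ j, a j * y j)
      = gaussianReal 0 1 := by
  have hm : Measurable (fun a : Fin N → ℝ => ∑ j, a j * y j) := by fun_prop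
  have : IsProbabilityMeasure ((Measure.pi fun _ : Fin N => gaussianReal 0 1).map
      (fun a => ∑ j, a j * y j)) := Measure.isProbabilityMeasure_map hm.aemeasurable
  apply Measure.ext_of_charFun
  ext t
  have h1 := charFun_stdGaussian (E := EuclideanSpace ℝ (Fin N)) (t • WithLp.toLp 2 y)
  rw [← map_pi_eq_stdGaussian, charFun_apply, integral_map (by fun_prop) (by fun_prop)] at h1
  rw [charFun_apply, integral_map hm.aemeasurable (by fun_prop), charFun_gaussianReal]
  have h2 : ‖t • WithLp.toLp 2 y‖ ^ 2 = t ^ 2 := by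
    rw [norm_smul, mul_pow, EuclideanSpace.norm_sq_eq]
    simp [hy]
  rw [← Complex.ofReal_pow, h2] at h1
  convert h1 using 2
  · ext a
    simp [PiLp.inner_apply, Finset.mul_sum, Finset.sum_mul]
    congr 2
    funext i
    ring
  · push_cast; ring_nf

lemma lint_exp_sq (l : ℝ) (hl : l < 1 / 2) :
    ∫⁻ x, ENNReal.ofReal (Real.exp (l * x ^ 2)) ∂(gaussianReal 0 1)
      = ENNReal.ofReal ((Real.sqrt (1 - 2 * l))⁻¹) := by
  rw [gaussianReal_of_var_ne_zero _ (by simp), lintegral_withDensity_eq_lintegral_mul _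
    (measurable_gaussianPDF _ _) (by fun_prop)]
  have hb : (0 : ℝ) < 1 / 2 - l := by linarith
  have h1 : ∀ x : ℝ, (gaussianPDF 0 1 * fun x => ENNReal.ofReal (Real.exp (l * x ^ 2))) x
      = ENNReal.ofReal ((Real.sqrt (2 * Real.pi))⁻¹ * Real.exp (-(1 / 2 - l) * x ^ 2)) := by
    intro x
    simp only [Pi.mul_apply, gaussianPDF, gaussianPDFReal]
    rw [← ENNReal.ofReal_mul (by positivity), mul_assoc, ← Real.exp_add]
    simp
    ring_nf
  simp_rw [h1]
  rw [← ofReal_integral_eq_lintegral_ofReal ((integrable_exp_neg_mul_sq hb).const_mul _)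
    (Filter.Eventually.of_forall fun x => by positivity), integral_const_mul, integral_gaussian]
  congr 1
  rw [← Real.sqrt_inv, ← Real.sqrt_inv, ← Real.sqrt_mul (by positivity)]
  congr 1
  have := Real.pi_pos
  have : 1 - 2 * l ≠ 0 := by linarith
  field_simp

lemma lint_prod {m N : ℕ} (y : Fin N → ℝ) (hy : ∑ i, y i ^ 2 = 1) (f : ℝ → ENNReal)
    (hf : Measurable f) :
    ∫⁻ A, ∏ i, f (∑ j, A i j * y j) ∂(Measure.pi fun _ : Fin m => Measure.pi fun _ : Fin N => gaussianReal 0 1)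
      = (∫⁻ x, f x ∂(gaussianReal 0 1)) ^ m := by
  have hg : Measurable (fun a : Fin N → ℝ => f (∑ j, a j * y j)) := by fun_prop
  have hind := iIndepFun_pi (μ := fun _ : Fin m => Measure.pi fun _ : Fin N => gaussianReal 0 1)
    (X := fun _ a => f (∑ j, a j * y j)) (fun _ => hg.aemeasurable)
  rw [lintegral_prod_eq_prod_lintegral_of_indepFun Finset.univ
    (fun (i : Fin m) (A : Fin m → Fin N → ℝ) => f (∑ j, A i j * y j)) hind
    (fun i => by fun_prop)]
  have : ∀ i : Fin m, ∫⁻ A : Fin m → Fin N → ℝ, f (∑ j, A i j * y j) ∂(Measure.pi fun _ : Fin m => Measure.pi fun _ : Fin N => gaussianReal 0 1) = ∫⁻ x, f x ∂(gaussianReal 0 1) := by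
    intro i
    have h2 : ∫⁻ x, f x ∂(gaussianReal 0 1) = ∫⁻ a : Fin N → ℝ, f (∑ j, a j * y j) ∂(Measure.pi fun _ : Fin N => gaussianReal 0 1) := by
      conv_lhs => rw [← law_aux y hy, lintegral_map hf (by fun_prop)]
    rw [h2]
    exact (measurePreserving_eval (fun _ : Fin m => Measure.pi fun _ : Fin N => gaussianReal 0 1) i).lintegral_comp hg
  simp [this]

lemma chernoff {m N : ℕ} (y : Fin N → ℝ) (hy : ∑ i, y i ^ 2 = 1) (F : ℝ → ℝ)
    (hF : Measurable F) (M u : ℝ)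
    (hM : ∫⁻ x, ENNReal.ofReal (Real.exp (F x)) ∂(gaussianReal 0 1)
      ≤ ENNReal.ofReal (Real.exp M)) :
    (Measure.pi fun _ : Fin m => Measure.pi fun _ : Fin N => gaussianReal 0 1)
      {A | u ≤ ∑ i, F (∑ j, A i j * y j)} ≤ ENNReal.ofReal (Real.exp (m * M - u)) := by
  have h1 := lint_prod (m := m) y hy (fun x => ENNReal.ofReal (Real.exp (F x))) (by fun_prop)
  set μ := (Measure.pi fun _ : Fin m => Measure.pi fun _ : Fin N => gaussianReal 0 1)
  have h2 : {A : Fin m → Fin N → ℝ | u ≤ ∑ i, F (∑ j, A i j * y j)} ⊆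
      {A | ENNReal.ofReal (Real.exp u) ≤
        ∏ i, ENNReal.ofReal (Real.exp (F (∑ j, A i j * y j)))} := by
    intro A hA
    simp only [Set.mem_ofPred_eq] at hA ⊢
    rw [← ENNReal.ofReal_prod_of_nonneg (fun i _ => (Real.exp_pos _).le), ← Real.exp_sum]
    exact ENNReal.ofReal_le_ofReal (Real.exp_le_exp.2 hA)
  refine (measure_mono h2).trans ?_
  have hmeas : Measurable (fun A : Fin m → Fin N → ℝ =>
      ∏ i, ENNReal.ofReal (Real.exp (F (∑ j, A i j * y j)))) := by fun_prop
  refine (meas_ge_le_lintegral_div hmeas.aemeasurable (by simp [Real.exp_pos]) (by simp)).trans ?_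
  rw [h1]
  apply ENNReal.div_le_of_le_mul
  rw [← ENNReal.ofReal_mul (Real.exp_pos _).le, ← Real.exp_add]
  refine (pow_le_pow_left₀ (by simp) hM m).trans ?_
  rw [← ENNReal.ofReal_pow (Real.exp_pos _).le, ← Real.exp_nat_mul]
  simp

lemma mgf_sq (l : ℝ) (hl : |l| ≤ 1 / 10) :
    ∫⁻ x, ENNReal.ofReal (Real.exp (l * x ^ 2)) ∂(gaussianReal 0 1)
      ≤ ENNReal.ofReal (Real.exp (l + 4 * l ^ 2)) := by
  obtain ⟨h1, h2⟩ := abs_le.1 hl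
  rw [lint_exp_sq l (by linarith)]
  apply ENNReal.ofReal_le_ofReal
  have hw : |(-2 * l - 8 * l ^ 2)| ≤ 1 := by rw [abs_le]; constructor <;> nlinarith
  have h3 := (abs_le.1 (Real.abs_exp_sub_one_sub_id_le hw)).2
  have h4 : Real.exp (-2 * l - 8 * l ^ 2) ≤ 1 - 2 * l := by
    have : (-2 * l - 8 * l ^ 2) ^ 2 ≤ 8 * l ^ 2 := by
      have : (1 + 4 * l) ^ 2 ≤ 2 := by nlinarith
      nlinarith [mul_le_mul_of_nonneg_left this (sq_nonneg (2 * l))]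
    linarith
  have h5 : Real.exp (-(l + 4 * l ^ 2)) ≤ Real.sqrt (1 - 2 * l) := by
    apply Real.le_sqrt_of_sq_le
    rw [← Real.exp_nat_mul]
    refine le_trans (le_of_eq ?_) h4
    congr 1; push_cast; ring
  calc (Real.sqrt (1 - 2 * l))⁻¹ ≤ (Real.exp (-(l + 4 * l ^ 2)))⁻¹ :=
        inv_anti₀ (Real.exp_pos _) h5
    _ = _ := by rw [Real.exp_neg, inv_inv]

lemma mgf_excess (τ : ℝ) :
    ∫⁻ x, ENNReal.ofReal (Real.exp (1 / 4 * max (x ^ 2 - τ) 0)) ∂(gaussianReal 0 1)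
      ≤ ENNReal.ofReal (Real.exp (2 * Real.exp (-τ / 4))) := by
  have h1 : ∀ x : ℝ, ENNReal.ofReal (Real.exp (1 / 4 * max (x ^ 2 - τ) 0)) ≤
      1 + ENNReal.ofReal (Real.exp (-τ / 4)) * ENNReal.ofReal (Real.exp (1 / 4 * x ^ 2)) := by
    intro x
    rw [← ENNReal.ofReal_mul (Real.exp_pos _).le, ← Real.exp_add, ← ENNReal.ofReal_one,
      ← ENNReal.ofReal_add zero_le_one (Real.exp_pos _).le]
    apply ENNReal.ofReal_le_ofReal
    rcases max_cases (x ^ 2 - τ) 0 with ⟨h, _⟩ | ⟨h, _⟩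
    · rw [h]
      have : 1 / 4 * (x ^ 2 - τ) = -τ / 4 + 1 / 4 * x ^ 2 := by ring
      rw [this]; linarith
    · rw [h]; simp [(Real.exp_pos _).le]
  refine (lintegral_mono h1).trans ?_
  rw [lintegral_add_left (by fun_prop), lintegral_const_mul _ (by fun_prop), lint_exp_sq _ (by norm_num)]
  rw [← ENNReal.ofReal_mul (Real.exp_pos _).le]
  simp only [lintegral_const, measure_univ, mul_one]
  rw [← ENNReal.ofReal_one, ← ENNReal.ofReal_add zero_le_one (by positivity)]
  apply ENNReal.ofReal_le_ofReal
  have h2 : (Real.sqrt (1 - 2 * (1 / 4)))⁻¹ ≤ 2 := by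
    rw [inv_le_comm₀ (by norm_num) (by norm_num)]
    apply Real.le_sqrt_of_sq_le; norm_num
  have h3 := Real.add_one_le_exp (2 * Real.exp (-τ / 4))
  nlinarith [Real.exp_pos (-τ / 4)]

/-- polarization bound -/
lemma bil_bound {E : Type*} [NormedAddCommGroup E] [InnerProductSpace ℝ E]
    (b : E →ₗ[ℝ] E →ₗ[ℝ] ℝ) (hb : ∀ x y, b x y = b y x) (K : ℝ)
    (hK : ∀ x, |b x x| ≤ K * ‖x‖ ^ 2) (p r : E) : |b p r| ≤ K * (‖p‖ * ‖r‖) := by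
  rcases eq_or_ne p 0 with rfl | hp
  · simp
  rcases eq_or_ne r 0 with rfl | hr
  · simp
  have hp' := norm_pos_iff.2 hp
  have hr' := norm_pos_iff.2 hr
  have h1 := abs_le.1 (hK (‖r‖ • p + ‖p‖ • r))
  have h2 := abs_le.1 (hK (‖r‖ • p - ‖p‖ • r))
  have h3 := parallelogram_law_with_norm ℝ (‖r‖ • p) (‖p‖ • r)
  simp only [norm_smul, norm_norm] at h3
  simp only [map_add, map_sub, map_smul, LinearMap.add_apply, LinearMap.sub_apply,
    LinearMap.smul_apply, smul_eq_mul, hb r p] at h1 h2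
  set n1 := ‖‖r‖ • p + ‖p‖ • r‖
  set n2 := ‖‖r‖ • p - ‖p‖ • r‖
  have h4 : K * n1 ^ 2 + K * n2 ^ 2 = K * (4 * (‖p‖ * ‖r‖) * (‖p‖ * ‖r‖)) := by
    rw [← mul_add]; congr 1; nlinarith
  have hpos : 0 < 4 * (‖p‖ * ‖r‖) := by positivity
  rw [abs_le]
  constructor
  · refine le_of_mul_le_mul_left ?_ hpos
    nlinarith [h1.1, h2.2]
  · refine le_of_mul_le_mul_left ?_ hpos
    nlinarith [h1.2, h2.1]

lemma net_bound {E : Type*} [NormedAddCommGroup E] [InnerProductSpace ℝ E]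
    [FiniteDimensional ℝ E] (b : E →ₗ[ℝ] E →ₗ[ℝ] ℝ) (hb : ∀ x y, b x y = b y x)
    (net : Finset E) (hn : ∀ x : E, ‖x‖ = 1 → ∃ y ∈ net, ‖y‖ = 1 ∧ ‖x - y‖ ≤ 1 / 2)
    (a : ℝ) (ha : ∀ y ∈ net, |b y y| ≤ a) (x : E) : |b x x| ≤ 32 * a * ‖x‖ ^ 2 := by
  rcases eq_or_ne x 0 with rfl | hx0
  · simp
  have hc : Continuous (fun x : E => |b x x|) := by
    have : (fun x : E => |b x x|) = fun x : E => |(LinearMap.toContinuousLinearMap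
      (LinearMap.toContinuousLinearMap.toLinearMap ∘ₗ b)) x x| := by
      ext; rfl
    rw [this]; fun_prop
  have hne : (Metric.sphere (0 : E) 1).Nonempty := by
    refine ⟨‖x‖⁻¹ • x, ?_⟩
    simp [norm_smul, hx0]
  obtain ⟨z, hz, hmax⟩ := (isCompact_sphere (0 : E) 1).exists_isMaxOn hne hc.continuousOn
  have hz1 : ‖z‖ = 1 := by simpa using hz
  set K := |b z z| with hKdef
  have hK0 : 0 ≤ K := abs_nonneg _
  have hK : ∀ x, |b x x| ≤ K * ‖x‖ ^ 2 := by
    intro x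
    rcases eq_or_ne x 0 with rfl | hx
    · simp
    have hp := norm_pos_iff.2 hx
    have h1 : |b (‖x‖⁻¹ • x) (‖x‖⁻¹ • x)| ≤ K := hmax (by simp [norm_smul, hx])
    simp only [map_smul, LinearMap.smul_apply, smul_eq_mul, abs_mul, abs_inv, abs_norm] at h1
    have h2 : |b x x| = (‖x‖⁻¹ * (‖x‖⁻¹ * |b x x|)) * ‖x‖ ^ 2 := by field_simp
    rw [h2]
    exact mul_le_mul_of_nonneg_right h1 (by positivity)
  obtain ⟨y, hy, hy1, hyd⟩ := hn z hz1
  have h1 := bil_bound b hb K hK (z - y) (z + y)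
  have h2 : b (z - y) (z + y) = b z z - b y y := by
    simp only [map_add, map_sub, LinearMap.sub_apply, hb y z]; ring
  have h3 : ‖z - y‖ * ‖z + y‖ ≤ 31 / 32 := by
    have h4 := parallelogram_law_with_norm ℝ z y
    rw [hz1, hy1] at h4
    have h5 : (‖z - y‖ * ‖z + y‖) ^ 2 ≤ (31 / 32) ^ 2 := by
      have h6 : ‖z + y‖ ^ 2 = 4 - ‖z - y‖ ^ 2 := by nlinarith
      have h7 : ‖z - y‖ ^ 2 ≤ 1 / 4 := by nlinarith [norm_nonneg (z - y)]
      rw [mul_pow, h6]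
      nlinarith
    exact le_of_sq_le_sq h5 (by norm_num)
  rw [h2] at h1
  have h4 := ha y hy
  have h5 : K ≤ |b z z - b y y| + |b y y| := by
    have := abs_add_le (b z z - b y y) (b y y)
    simpa using this
  have h6 := mul_le_mul_of_nonneg_left h3 hK0
  have h7 : K ≤ 32 * a := by linarith
  exact (hK x).trans (mul_le_mul_of_nonneg_right h7 (by positivity))

lemma exists_net (E : Type*) [NormedAddCommGroup E] [InnerProductSpace ℝ E]
    [FiniteDimensional ℝ E] : ∃ net : Finset E, net.card ≤ 5 ^ Module.finrank ℝ E ∧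
      (∀ y ∈ net, ‖y‖ = 1) ∧ 
      ∀ x : E, ‖x‖ = 1 → ∃ y ∈ net, ‖y‖ = 1 ∧ ‖x - y‖ ≤ 1 / 2 := by
  classical
  let P : Finset E → Prop := fun t => (∀ y ∈ t, ‖y‖ = 1) ∧
    ∀ c ∈ t, ∀ d ∈ t, c ≠ d → 1 / 2 ≤ ‖c - d‖
  have hcard : ∀ t, P t → t.card ≤ 5 ^ Module.finrank ℝ E := by
    intro t ht
    have hinj : Function.Injective (fun x : E => (2 : ℝ) • x) := smul_right_injective E two_ne_zero
    rw [← Finset.card_image_of_injective t hinj]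
    apply Besicovitch.card_le_of_separated
    · intro c hc
      obtain ⟨d, hd, rfl⟩ := Finset.mem_image.1 hc
      simp [norm_smul, ht.1 d hd]
    · intro c hc d hd hcd
      obtain ⟨c, hc', rfl⟩ := Finset.mem_image.1 hc
      obtain ⟨d, hd', rfl⟩ := Finset.mem_image.1 hd
      have := ht.2 c hc' d hd' (fun h => hcd (by rw [h]))
      rw [← smul_sub, norm_smul]
      norm_num
      linarith
  have hex : ∃ n, ∃ t, P t ∧ t.card = n := ⟨0, ∅, by simp [P], rfl⟩
  obtain ⟨t, ht, htc⟩ := Nat.findGreatest_spec (P := fun n => ∃ t, P t ∧ t.card = n)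
    (Nat.zero_le (5 ^ Module.finrank ℝ E)) ⟨∅, by simp [P], rfl⟩
  refine ⟨t, hcard t ht, ht.1, ?_⟩
  intro x hx
  by_contra! hcon
  have hxt : x ∉ t := fun h => by
    have := hcon x h hx
    norm_num at this
  have hP : P (insert x t) := by
    refine ⟨?_, ?_⟩
    · intro y hy
      rcases Finset.mem_insert.1 hy with rfl | hy
      · exact hx
      · exact ht.1 y hy
    · intro c hc d hd hcd
      rcases Finset.mem_insert.1 hc with hc' | hc' <;> rcases Finset.mem_insert.1 hd with hd' | hd'
      · exact absurd (hc'.trans hd'.symm) hcd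
      · rw [hc']; exact (hcon d hd' (ht.1 d hd')).le
      · rw [hd', norm_sub_rev]; exact (hcon c hc' (ht.1 c hc')).le
      · exact ht.2 c hc' d hd' hcd
  have := Nat.le_findGreatest (P := fun n => ∃ t, P t ∧ t.card = n) (hcard _ hP) ⟨_, hP, rfl⟩
  rw [Finset.card_insert_of_notMem hxt, htc] at this
  omega

/-- extension by zero -/
noncomputable def extZ {N : ℕ} (S : Finset (Fin N)) :
    EuclideanSpace ℝ S →ₗ[ℝ] (Fin N → ℝ) where
  toFun z j := if h : j ∈ S then z ⟨j, h⟩ else 0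
  map_add' x y := by ext j; by_cases h : j ∈ S <;> simp [h]
  map_smul' c x := by ext j; by_cases h : j ∈ S <;> simp [h]

lemma extZ_sq {N : ℕ} (S : Finset (Fin N)) (z : EuclideanSpace ℝ S) :
    ∑ j, extZ S z j ^ 2 = ‖z‖ ^ 2 := by
  rw [EuclideanSpace.norm_sq_eq]
  rw [← Finset.sum_subset (Finset.subset_univ S) (by intro j _ hj; simp [extZ, hj])]
  rw [← Finset.sum_coe_sort]
  apply Finset.sum_congr rfl
  intro j _
  simp [extZ]

lemma net_quad {m N : ℕ} (S : Finset (Fin N)) (A : Fin m → Fin N → ℝ)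
    (net : Finset (EuclideanSpace ℝ S))
    (hn : ∀ x : EuclideanSpace ℝ S, ‖x‖ = 1 → ∃ y ∈ net, ‖y‖ = 1 ∧ ‖x - y‖ ≤ 1 / 2)
    (w : Fin m → ℝ) (v a : ℝ)
    (ha : ∀ y ∈ net, |∑ i, w i * (∑ j, A i j * extZ S y j) ^ 2 - v * ‖y‖ ^ 2| ≤ a)
    (x : EuclideanSpace ℝ S) :
    |∑ i, w i * (∑ j, A i j * extZ S x j) ^ 2 - v * ‖x‖ ^ 2| ≤ 32 * a * ‖x‖ ^ 2 := by
  let L : Fin m → EuclideanSpace ℝ S →ₗ[ℝ] ℝ := fun i =>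
    { toFun := fun z => ∑ j, A i j * extZ S z j
      map_add' := fun x y => by simp [mul_add, Finset.sum_add_distrib]
      map_smul' := fun c x => by
        simp only [map_smul, Pi.smul_apply, smul_eq_mul, RingHom.id_apply, Finset.mul_sum]
        exact Finset.sum_congr rfl fun j _ => by ring }
  let b : EuclideanSpace ℝ S →ₗ[ℝ] EuclideanSpace ℝ S →ₗ[ℝ] ℝ :=
    ∑ i, w i • (LinearMap.mul ℝ ℝ).compl₁₂ (L i) (L i) - v • innerₗ (EuclideanSpace ℝ S)
  have hbb : ∀ x y, b x y = ∑ i, w i * (L i x * L i y) - v * inner ℝ x y := by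
    intro x y
    simp [b, LinearMap.sum_apply]
  have hq : ∀ x, b x x = ∑ i, w i * (∑ j, A i j * extZ S x j) ^ 2 - v * ‖x‖ ^ 2 := by
    intro x
    rw [hbb, real_inner_self_eq_norm_sq]
    congr 1
    exact Finset.sum_congr rfl fun i _ => by rw [sq]; rfl
  have hsymm : ∀ x y, b x y = b y x := by
    intro x y
    rw [hbb, hbb, real_inner_comm]
    congr 1
    exact Finset.sum_congr rfl fun i _ => by ring
  have := net_bound b hsymm net hn a (fun y hy => by rw [hq]; exact ha y hy) x
  rwa [hq] at this

lemma rip_of_good {m N s k : ℕ} (hm : 0 < m) (hs : s ≤ N) (δ τ : ℝ) (hδ : 0 < δ) (hτ : 0 ≤ τ)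
    (hkτ : k * τ ≤ δ ^ 2 * m / 256) (A : Fin m → Fin N → ℝ)
    (net : (S : Finset (Fin N)) → Finset (EuclideanSpace ℝ S))
    (hn1 : ∀ S, ∀ y ∈ net S, ‖y‖ = 1)
    (hn : ∀ S : Finset (Fin N), ∀ x : EuclideanSpace ℝ S, ‖x‖ = 1 → ∃ y ∈ net S, ‖y‖ = 1 ∧ ‖x - y‖ ≤ 1 / 2)
    (hg : ∀ S ∈ Finset.powersetCard s (Finset.univ : Finset (Fin N)), ∀ z ∈ net S,
      ∑ i, (∑ j, A i j * extZ S z j) ^ 2 ≤ m * (1 + δ / 64) ∧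
      m * (1 - δ / 64) ≤ ∑ i, (∑ j, A i j * extZ S z j) ^ 2 ∧
      ∑ i, max ((∑ j, A i j * extZ S z j) ^ 2 - τ) 0 ≤ δ ^ 2 * m / 256) :
    RIPCorR ((Real.sqrt (m : ℝ))⁻¹ • Matrix.of A) s k δ := by
  intro x c hx hc
  obtain ⟨S0, hS0, hxS0⟩ := hx
  obtain ⟨T, hT, hcT⟩ := hc
  obtain ⟨S, hS0S, hS⟩ := Finset.exists_superset_card_eq hS0 (by simpa using hs)
  have hxS : ∀ i ∉ S, x i = 0 := fun i hi => hxS0 i fun h => hi (hS0S h)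
  have hm' : (0 : ℝ) < m := by exact_mod_cast hm
  have hg := hg S (by simp [Finset.mem_powersetCard, hS])
  set z : EuclideanSpace ℝ S := WithLp.toLp 2 (fun j => x j) with hz
  have hext : extZ S z = x := by
    ext j
    by_cases h : j ∈ S
    · simp [extZ, h, hz]
    · simp [extZ, h, hxS j h]
  have hzn : ‖z‖ ^ 2 = ∑ j, x j ^ 2 := by rw [← extZ_sq, hext]
  have h1 := net_quad S A (net S) (hn S) (fun _ => (m : ℝ)⁻¹) 1 (δ / 64) (by
    intro y hy
    obtain ⟨ha, hb, -⟩ := hg y hy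
    rw [← Finset.mul_sum, hn1 S y hy, abs_le]
    constructor
    · have : (1 - δ / 64) ≤ (m : ℝ)⁻¹ * ∑ i, (∑ j, A i j * extZ S y j) ^ 2 := by
        rw [inv_mul_eq_div, le_div_iff₀ hm']; linarith
      linarith
    · have : (m : ℝ)⁻¹ * ∑ i, (∑ j, A i j * extZ S y j) ^ 2 ≤ (1 + δ / 64) := by
        rw [inv_mul_eq_div, div_le_iff₀ hm']; linarith
      linarith) z
  have h2 := net_quad S A (net S) (hn S) (fun i => if i ∈ T then 1 else 0) 0 (δ ^ 2 * m / 128) (by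
    intro y hy
    obtain ⟨-, -, hb⟩ := hg y hy
    simp only [ite_mul, one_mul, zero_mul, sub_zero, Finset.sum_ite_mem, Finset.univ_inter]
    rw [abs_of_nonneg (Finset.sum_nonneg fun i _ => sq_nonneg _)]
    calc ∑ i ∈ T, (∑ j, A i j * extZ S y j) ^ 2
        ≤ ∑ i ∈ T, (τ + max ((∑ j, A i j * extZ S y j) ^ 2 - τ) 0) :=
          Finset.sum_le_sum fun i _ => by
            have := le_max_left ((∑ j, A i j * extZ S y j) ^ 2 - τ) 0
            linarith
      _ = T.card * τ + ∑ i ∈ T, max ((∑ j, A i j * extZ S y j) ^ 2 - τ) 0 := by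
          rw [Finset.sum_add_distrib]; simp
      _ ≤ k * τ + ∑ i, max ((∑ j, A i j * extZ S y j) ^ 2 - τ) 0 := by
          gcongr
          · exact Finset.subset_univ _
      _ ≤ _ := by linarith) z
  simp only [ite_mul, one_mul, zero_mul, sub_zero, Finset.sum_ite_mem, Finset.univ_inter, hext, hzn,
    ← Finset.mul_sum] at h1 h2
  rw [abs_of_nonneg (Finset.sum_nonneg fun i _ => sq_nonneg _)] at h2
  have hsq : ∀ {n : ℕ} (v : Fin n → ℝ), l2normR v ^ 2 = ∑ i, v i ^ 2 := fun v =>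
    Real.sq_sqrt (Finset.sum_nonneg fun i _ => sq_nonneg _)
  rw [hsq, hsq, hsq]
  set g : Fin m → ℝ := fun i => ∑ j, A i j * x j with hgdef
  have hexp : ∑ i, (((Real.sqrt (m : ℝ))⁻¹ • Matrix.of A).mulVec x + c) i ^ 2 =
      (m : ℝ)⁻¹ * ∑ i, g i ^ 2 + 2 * (Real.sqrt (m : ℝ))⁻¹ * ∑ i ∈ T, g i * c i
        + ∑ i, c i ^ 2 := by
    have e1 : ∑ i ∈ T, g i * c i = ∑ i, g i * c i :=
      Finset.sum_subset (Finset.subset_univ T) (fun i _ hi => by simp [hcT i hi])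
    have e2 : (m : ℝ)⁻¹ = (Real.sqrt (m : ℝ))⁻¹ ^ 2 := by
      rw [inv_pow, Real.sq_sqrt hm'.le]
    rw [e1, e2, Finset.mul_sum, Finset.mul_sum, ← Finset.sum_add_distrib,
      ← Finset.sum_add_distrib]
    apply Finset.sum_congr rfl
    intro i _
    have : (((Real.sqrt (m : ℝ))⁻¹ • Matrix.of A).mulVec x + c) i
        = (Real.sqrt (m : ℝ))⁻¹ * g i + c i := by
      simp [Matrix.mulVec, dotProduct, hgdef, Finset.mul_sum, mul_assoc]
    rw [this]; ring
  rw [hexp]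
  have hX : 0 ≤ ∑ i, x i ^ 2 := Finset.sum_nonneg fun i _ => sq_nonneg _
  have hC : 0 ≤ ∑ i, c i ^ 2 := Finset.sum_nonneg fun i _ => sq_nonneg _
  set X := ∑ i, x i ^ 2
  set C := ∑ i, c i ^ 2
  set D := 2 * (Real.sqrt (m : ℝ))⁻¹ * ∑ i ∈ T, g i * c i with hD
  have hD2 : |D| ≤ δ * (X + C) / 2 := by
    apply abs_le_of_sq_le_sq _ (by positivity)
    have cs := Finset.sum_mul_sq_le_sq_mul_sq T g c
    have e3 : ∑ i ∈ T, c i ^ 2 ≤ C :=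
      Finset.sum_le_univ_sum_of_nonneg fun i => sq_nonneg _
    have e4 : (∑ i ∈ T, g i * c i) ^ 2 ≤ (32 * (δ ^ 2 * m / 128) * X) * C :=
      cs.trans (mul_le_mul h2 e3 (Finset.sum_nonneg fun i _ => sq_nonneg _) (by positivity))
    have e5 : D ^ 2 = 4 * (m : ℝ)⁻¹ * (∑ i ∈ T, g i * c i) ^ 2 := by
      rw [hD, mul_pow, mul_pow, inv_pow, Real.sq_sqrt hm'.le]; ring
    have e6 : D ^ 2 ≤ δ ^ 2 * (X * C) := by
      rw [e5]
      calc _ ≤ 4 * (m : ℝ)⁻¹ * ((32 * (δ ^ 2 * m / 128) * X) * C) := by gcongr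
        _ = _ := by field_simp; ring
    nlinarith [mul_nonneg (sq_nonneg δ) (sq_nonneg (X - C))]
  obtain ⟨h1a, h1b⟩ := abs_le.1 h1
  obtain ⟨hDa, hDb⟩ := abs_le.1 hD2
  have := mul_nonneg hδ.le hC
  constructor <;> nlinarith

lemma count_bound (N s : ℕ) (hs : 1 ≤ s) (hsN : s ≤ N) :
    ((N.choose s : ℝ) * 5 ^ s) ≤ Real.exp (4 * (s * Real.log (2 * N / s))) := by
  have hs' : (0 : ℝ) < s := by exact_mod_cast hs
  have hN' : (s : ℝ) ≤ N := by exact_mod_cast hsN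
  have hN0 : (0 : ℝ) < N := by linarith
  have h1 : (N.choose s : ℝ) ≤ (N / s : ℝ) ^ s * Real.exp s := by
    refine (Nat.choose_le_pow_div s N).trans ?_
    have h2 := Real.pow_div_factorial_le_exp (x := s) hs'.le s
    calc (N : ℝ) ^ s / (s.factorial : ℝ) = (N / s : ℝ) ^ s * ((s : ℝ) ^ s / s.factorial) := by
          rw [div_pow]; field_simp
      _ ≤ _ := by gcongr
  have hr : 1 ≤ (N / s : ℝ) := by rwa [le_div_iff₀ hs', one_mul]
  have h3 : Real.exp (4 * (s * Real.log (2 * N / s))) = ((2 * (N / s : ℝ)) ^ 4) ^ s := by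
    rw [← pow_mul, mul_div_assoc, ← Real.exp_log (x := 2 * (N / s : ℝ)) (by positivity), ← Real.exp_nat_mul,
      Real.log_exp]
    congr 1; push_cast; ring
  rw [h3]
  have he : Real.exp s = Real.exp 1 ^ s := by rw [← Real.exp_nat_mul, mul_one]
  calc _ ≤ (N / s : ℝ) ^ s * Real.exp s * 5 ^ s := by gcongr
    _ = ((N / s : ℝ) * Real.exp 1 * 5) ^ s := by rw [he, mul_pow, mul_pow]
    _ ≤ _ := by
      apply pow_le_pow_left₀ (by positivity)
      have := Real.exp_one_lt_d9
      set r := (N / s : ℝ)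
      have hr3 : 1 ≤ r ^ 3 := one_le_pow₀ hr
      have : r * Real.exp 1 * 5 ≤ r * 16 := by nlinarith
      have : r * 1 ≤ r * r ^ 3 := by gcongr
      nlinarith

/-- Gaussian random matrices satisfy the RIP for the sparse corruptions
problem with high probability, under the stated measurement conditions. -/
theorem gaussian_ripCor_whp :
    ∃ c₁ c₂ : ℝ, 0 < c₁ ∧ 0 < c₂ ∧
      ∀ (N m s k : ℕ) (δ ε : ℝ), 0 < δ → δ ≤ 1 / 2 → 0 < ε → ε < 1 →
        1 ≤ s → s ≤ N → 1 ≤ k → k ≤ m →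
        (m : ℝ) ≥ c₁ * δ⁻¹ ^ 2 * (s * Real.log (2 * N / s) + Real.log (2 / ε)) →
        (m : ℝ) ≥ c₂ * δ⁻¹ ^ 2 * k * Real.log (1 / δ) →
        ENNReal.ofReal (1 - ε) ≤
          (Measure.pi fun _ : Fin m => Measure.pi fun _ : Fin N => gaussianReal 0 1)
            {A : Fin m → Fin N → ℝ |
              RIPCorR ((Real.sqrt (m : ℝ))⁻¹ • Matrix.of A) s k δ} := by
  refine ⟨262144, 14336, by norm_num, by norm_num, ?_⟩
  intro N m s k δ ε hδ hδ2 hε hε1 hs hsN hk hkm hm1 hm2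
  have hm0 : 0 < m := by omega
  have hm' : (0 : ℝ) < m := by exact_mod_cast hm0
  have hδsq : 0 < δ ^ 2 := by positivity
  have hcancel : δ ^ 2 * δ⁻¹ ^ 2 = 1 := by rw [← mul_pow, mul_inv_cancel₀ hδ.ne', one_pow]
  have hA : 4 * (s * Real.log (2 * N / s)) + 4 * Real.log (2 / ε) ≤ δ ^ 2 * m / 65536 := by
    have := mul_le_mul_of_nonneg_left hm1.le hδsq.le
    have e : δ ^ 2 * (262144 * δ⁻¹ ^ 2 * (s * Real.log (2 * N / s) + Real.log (2 / ε)))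
        = 262144 * (s * Real.log (2 * N / s) + Real.log (2 / ε)) := by
      calc _ = (δ ^ 2 * δ⁻¹ ^ 2) * (262144 * (s * Real.log (2 * N / s) + Real.log (2 / ε))) := by ring
        _ = _ := by rw [hcancel, one_mul]
    rw [e] at this
    linarith
  have hlog : 0 ≤ Real.log (1 / δ) := Real.log_nonneg (by rw [le_div_iff₀ hδ]; linarith)
  set τ := 56 * Real.log (1 / δ) with hτdef
  have hτ : 0 ≤ τ := by positivity
  have hkτ : k * τ ≤ δ ^ 2 * m / 256 := by
    have := mul_le_mul_of_nonneg_left hm2.le hδsq.le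
    have e : δ ^ 2 * (14336 * δ⁻¹ ^ 2 * k * Real.log (1 / δ))
        = 14336 * k * Real.log (1 / δ) := by
      calc _ = (δ ^ 2 * δ⁻¹ ^ 2) * (14336 * k * Real.log (1 / δ)) := by ring
        _ = _ := by rw [hcancel, one_mul]
    rw [e] at this
    rw [hτdef]
    linarith
  have hexpτ : 2 * Real.exp (-τ / 4) ≤ δ ^ 2 / 2048 := by
    have e1 : Real.exp (-τ / 4) = δ ^ 14 := by
      have : -τ / 4 = (14 : ℕ) * Real.log δ := by
        rw [hτdef, one_div, Real.log_inv]; push_cast; ring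
      rw [this, Real.exp_nat_mul, Real.exp_log hδ]
    have e2 : δ ^ 12 ≤ (1 / 2) ^ 12 := pow_le_pow_left₀ hδ.le hδ2 12
    rw [e1]
    have : δ ^ 14 = δ ^ 2 * δ ^ 12 := by ring
    rw [this]
    nlinarith [mul_le_mul_of_nonneg_left e2 hδsq.le]
  choose net hnc hn1 hn using fun S : Finset (Fin N) => exists_net (EuclideanSpace ℝ S)
  set μ := (Measure.pi fun _ : Fin m => Measure.pi fun _ : Fin N => gaussianReal 0 1) with hμ
  have : IsProbabilityMeasure μ := by rw [hμ]; infer_instance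
  set p := ENNReal.ofReal (Real.exp (-(δ ^ 2 * m / 65536))) with hp
  let B1 : (Fin N → ℝ) → Set (Fin m → Fin N → ℝ) := fun y =>
    {A | δ / 512 * (m * (1 + δ / 64)) ≤ ∑ i, δ / 512 * (∑ j, A i j * y j) ^ 2}
  let B2 : (Fin N → ℝ) → Set (Fin m → Fin N → ℝ) := fun y =>
    {A | -(δ / 512) * (m * (1 - δ / 64)) ≤ ∑ i, -(δ / 512) * (∑ j, A i j * y j) ^ 2}
  let B3 : (Fin N → ℝ) → Set (Fin m → Fin N → ℝ) := fun y =>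
    {A | δ ^ 2 * m / 1024 ≤ ∑ i, 1 / 4 * max ((∑ j, A i j * y j) ^ 2 - τ) 0}
  have hB : ∀ y : Fin N → ℝ, ∑ j, y j ^ 2 = 1 → μ (B1 y ∪ B2 y ∪ B3 y) ≤ 3 * p := by
    intro y hy
    have h1 : μ (B1 y) ≤ p := by
      refine (chernoff y hy (fun x => δ / 512 * x ^ 2) (by fun_prop) _ _
        (mgf_sq (δ / 512) (by rw [abs_of_pos (by positivity)]; linarith))).trans ?_
      apply ENNReal.ofReal_le_ofReal (Real.exp_le_exp.2 _)
      nlinarith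
    have h2 : μ (B2 y) ≤ p := by
      refine (chernoff y hy (fun x => -(δ / 512) * x ^ 2) (by fun_prop) _ _
        (mgf_sq (-(δ / 512)) (by rw [abs_neg, abs_of_pos (by positivity)]; linarith))).trans ?_
      apply ENNReal.ofReal_le_ofReal (Real.exp_le_exp.2 _)
      nlinarith
    have h3 : μ (B3 y) ≤ p := by
      refine (chernoff y hy (fun x => 1 / 4 * max (x ^ 2 - τ) 0) (by fun_prop) _ _
        (mgf_excess τ)).trans ?_
      apply ENNReal.ofReal_le_ofReal (Real.exp_le_exp.2 _)
      have := mul_le_mul_of_nonneg_left hexpτ hm'.le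
      nlinarith [mul_pos hδsq hm']
    calc μ (B1 y ∪ B2 y ∪ B3 y) ≤ μ (B1 y) + μ (B2 y) + μ (B3 y) :=
          (measure_union_le _ _).trans (by gcongr; exact measure_union_le _ _)
      _ ≤ p + p + p := by gcongr
      _ = 3 * p := by ring
  set good := {A : Fin m → Fin N → ℝ | RIPCorR ((Real.sqrt (m : ℝ))⁻¹ • Matrix.of A) s k δ}
    with hgood
  let bad : Set (Fin m → Fin N → ℝ) :=
    ⋃ S ∈ Finset.powersetCard s (Finset.univ : Finset (Fin N)), ⋃ z ∈ net S,
      (B1 (extZ S z) ∪ B2 (extZ S z) ∪ B3 (extZ S z))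
  have hsub : goodᶜ ⊆ bad := by
    intro A hA
    by_contra hbad
    apply hA
    refine rip_of_good hm0 hsN δ τ hδ hτ hkτ A net hn1 hn ?_
    intro S hS z hz
    have hnot : A ∉ B1 (extZ S z) ∪ B2 (extZ S z) ∪ B3 (extZ S z) := fun h =>
      hbad (Set.mem_biUnion hS (Set.mem_biUnion hz h))
    simp only [Set.mem_union, not_or, B1, B2, B3, Set.mem_ofPred_eq, not_le,
      ← Finset.mul_sum] at hnot
    obtain ⟨⟨n1, n2⟩, n3⟩ := hnot
    have hd : 0 < δ / 512 := by positivity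
    refine ⟨(lt_of_mul_lt_mul_left n1 hd.le).le, ?_, by linarith⟩
    rw [neg_mul, neg_mul, neg_lt_neg_iff] at n2
    exact (lt_of_mul_lt_mul_left n2 hd.le).le
  have hbad : μ bad ≤ ENNReal.ofReal ε := by
    calc μ bad ≤ ∑ S ∈ Finset.powersetCard s (Finset.univ : Finset (Fin N)), ∑ z ∈ net S,
          μ (B1 (extZ S z) ∪ B2 (extZ S z) ∪ B3 (extZ S z)) :=
          (measure_biUnion_finset_le _ _).trans
            (Finset.sum_le_sum fun S _ => measure_biUnion_finset_le _ _)
      _ ≤ ∑ S ∈ Finset.powersetCard s (Finset.univ : Finset (Fin N)), (5 ^ s : ENNReal) * (3 * p) := by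
          apply Finset.sum_le_sum
          intro S hS
          have hcS : S.card = s := (Finset.mem_powersetCard.1 hS).2
          calc _ ≤ ∑ z ∈ net S, 3 * p := Finset.sum_le_sum fun z hz =>
                hB _ (by rw [extZ_sq, hn1 S z hz]; norm_num)
            _ = ((net S).card : ENNReal) * (3 * p) := by simp
            _ ≤ _ := by
              gcongr
              have := hnc S
              rw [finrank_euclideanSpace, Fintype.card_coe, hcS] at this
              exact_mod_cast this
      _ = ENNReal.ofReal ((N.choose s : ℝ) * 5 ^ s * (3 * Real.exp (-(δ ^ 2 * m / 65536)))) := by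
          rw [Finset.sum_const, Finset.card_powersetCard, Finset.card_univ, Fintype.card_fin,
            nsmul_eq_mul, ENNReal.ofReal_mul (by positivity), ENNReal.ofReal_mul (by positivity),
            ENNReal.ofReal_mul (by positivity), ENNReal.ofReal_pow (by positivity),
            ENNReal.ofReal_natCast, hp, mul_assoc]
          simp
      _ ≤ ENNReal.ofReal ε := by
          apply ENNReal.ofReal_le_ofReal
          have hc := count_bound N s hs hsN
          have h2ε : (1 : ℝ) ≤ 2 / ε := by rw [le_div_iff₀ hε]; linarith
          calc _ ≤ Real.exp (4 * (s * Real.log (2 * N / s))) *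
                (3 * Real.exp (-(δ ^ 2 * m / 65536))) := by gcongr
            _ = 3 * Real.exp (4 * (s * Real.log (2 * N / s)) + (-(δ ^ 2 * m / 65536))) := by
                rw [Real.exp_add]; ring
            _ ≤ 3 * Real.exp (-(4 : ℕ) * Real.log (2 / ε)) := by
                gcongr
                push_cast
                linarith
            _ = 3 * (ε / 2) ^ 4 := by
                rw [neg_mul, ← mul_neg, ← Real.log_inv, Real.exp_nat_mul,
                  Real.exp_log (by positivity), inv_div]
            _ ≤ ε := by
                have : ε ^ 3 ≤ 1 := pow_le_one₀ hε.le hε1.le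
                have : ε * ε ^ 3 ≤ ε * 1 := by gcongr
                nlinarith
  have hone : (1 : ENNReal) ≤ μ good + ENNReal.ofReal ε := by
    calc (1 : ENNReal) = μ (good ∪ goodᶜ) := by rw [Set.union_compl_self, measure_univ]
      _ ≤ μ good + μ goodᶜ := measure_union_le _ _
      _ ≤ _ := by gcongr; exact (measure_mono hsub).trans hbad
  rw [ENNReal.ofReal_sub _ hε.le, ENNReal.ofReal_one]
  exact tsub_le_iff_right.2 hone
end
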